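/- arXiv:2203.05541 — 2 statements merged into one kernel-verified Lean document; each statement's English description precedes it below -/
import Mathlib

section
/- The only pairs (x, y) of rational numbers satisfying y^2 = x^8 + 6x^7 + 11x^6 + 24x^5 + 21x^4 + 24x^3 + 11x^2 + 6x + 1 are (0, 1) and (0, -1). -/
/-- The common value of the two quotients in `u ^ 2 * P = v ^ 2 * Q` with `u`, `v` coprime. -/
theorem exists_eq_mul_sq_of_sq_mul_eq {u v P Q : ℤ} (hv : v ≠ 0) (huv : IsCoprime u v)
    (h : u ^ 2 * P = v ^ 2 * Q) : ∃ e, P = e * v ^ 2 ∧ Q = e * u ^ 2 := by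
  obtain ⟨e, he⟩ : v ^ 2 ∣ P := (huv.symm.pow (m := 2) (n := 2)).dvd_of_dvd_mul_left ⟨Q, h⟩
  refine ⟨e, by rw [he]; ring, mul_left_cancel₀ (pow_ne_zero 2 hv) ?_⟩
  rw [← h, he]
  ring

/-- An integer dividing `7 * u ^ 2` and `7 * v ^ 2` with `u`, `v` coprime divides `7`. -/
theorem eq_of_dvd_seven_mul_sq {u v e : ℤ} (huv : IsCoprime u v)
    (hu : e ∣ 7 * u ^ 2) (hv : e ∣ 7 * v ^ 2) : e = 1 ∨ e = -1 ∨ e = 7 ∨ e = -7 := by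
  have h7 : e ∣ 7 := by
    obtain ⟨x, y, hxy⟩ := huv.pow (m := 2) (n := 2)
    have : (7 : ℤ) = x * (7 * u ^ 2) + y * (7 * v ^ 2) := by linear_combination -7 * hxy
    rw [this]
    exact dvd_add (hu.mul_left x) (hv.mul_left y)
  rcases (Nat.dvd_prime Nat.prime_seven).1 (Int.natAbs_dvd_natAbs.2 h7) with h | h <;> omega

theorem sq_emod_eight_of_odd {u : ℤ} (hu : Odd u) : u ^ 2 % 8 = 1 := by
  have := Int.eight_dvd_sq_sub_one_of_odd hu
  omega

/-- Two coprime factorizations of the same product refine to a common one. -/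
theorem exists_common_refinement {a b p q : ℤ} (ha : a ≠ 0) (h : a * b = p * q) :
    ∃ k l m n : ℤ, a = k * l ∧ b = m * n ∧ p = k * m ∧ q = l * n := by
  obtain ⟨k, l, ⟨m, hm⟩, ⟨n, hn⟩, rfl⟩ := exists_dvd_and_dvd_of_dvd_mul (Dvd.intro _ h)
  refine ⟨k, l, m, n, rfl, mul_left_cancel₀ ha ?_, hm, hn⟩
  rw [h, hm, hn]
  ring

/-- The even case of the second descent is impossible. -/
theorem second_descent_even {k l m n : ℤ} (hk : Even k) (hn0 : n ≠ 0)
    (hkn : IsCoprime k n) (hn : Odd n) (hl : Odd l) (hm : Odd m)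
    (h₁ : m ^ 2 - l ^ 2 = k * n) (h₂ : k ^ 2 - n ^ 2 = 3 * (l * m)) : False := by
  have h8 : (8 : ℤ) ∣ k := by
    have hc : IsCoprime (8 : ℤ) n := by
      simpa using (Int.isCoprime_two_left.2 hn).pow_left (m := 3)
    refine hc.dvd_of_dvd_mul_right ?_
    have h3 := sq_emod_eight_of_odd hl
    have h4 := sq_emod_eight_of_odd hm
    omega
  obtain ⟨j, rfl⟩ := h8
  obtain ⟨P, hP⟩ : (2 : ℤ) ∣ m - l := (hm.sub_odd hl).two_dvd
  obtain ⟨Q, hQ⟩ : (2 : ℤ) ∣ m + l := (hm.add_odd hl).two_dvd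
  have hPQ : n * (2 * j) = P * Q := by
    have : m ^ 2 - l ^ 2 = (m - l) * (m + l) := by ring
    rw [hP, hQ] at this
    linarith
  obtain ⟨β, δ, α, γ, rfl, hj, rfl, rfl⟩ := exists_common_refinement hn0 hPQ
  obtain rfl : m = β * α + δ * γ := by linarith
  obtain rfl : l = δ * γ - β * α := by linarith
  have hk4 : 8 * j = 4 * (α * γ) := by linarith
  rw [hk4] at h₂ hkn
  have hkn' : IsCoprime (α * γ) (β * δ) := hkn.of_mul_left_right
  have hγβ : IsCoprime γ β := hkn'.of_mul_left_right.of_mul_right_left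
  have hαδ : IsCoprime α δ := hkn'.of_mul_left_left.of_mul_right_right
  obtain ⟨e, he₁, he₂⟩ := exists_eq_mul_sq_of_sq_mul_eq (left_ne_zero_of_mul hn0) hγβ
    (P := 16 * α ^ 2 - 3 * δ ^ 2) (Q := δ ^ 2 - 3 * α ^ 2) (by linear_combination h₂)
  have he := eq_of_dvd_seven_mul_sq (e := e) hαδ
    ⟨β ^ 2 + 3 * γ ^ 2, by linear_combination he₁ + 3 * he₂⟩
    ⟨16 * γ ^ 2 + 3 * β ^ 2, by linear_combination 3 * he₁ + 16 * he₂⟩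
  have hβ := sq_emod_eight_of_odd (Int.odd_mul.1 hn).1
  have hδ := sq_emod_eight_of_odd (Int.odd_mul.1 hn).2
  rcases he with rfl | rfl | rfl | rfl <;> omega

/-- The odd case of the second descent leads to a smaller pair on which both quadratic forms are
squares. -/
theorem second_descent_odd {k l m n : ℤ} (hk : Odd k) (hn : Odd n) (hl0 : l ≠ 0) (hm0 : m ≠ 0)
    (hkn : IsCoprime k n) (hlm : IsCoprime l m) (hodd : Odd (m - l))
    (h₁ : m ^ 2 - l ^ 2 = k * n) (h₂ : k ^ 2 - n ^ 2 = 3 * (l * m)) :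
    ∃ a b r s : ℤ, IsCoprime a b ∧ a * b ≠ 0 ∧ a ^ 2 + a * b + b ^ 2 = r ^ 2 ∧
      a ^ 2 + 5 * (a * b) + b ^ 2 = s ^ 2 ∧ |a * b| < |k * l * m * n| := by
  have hk0 : k ≠ 0 := by rintro rfl; simp at hk
  have hn0 : n ≠ 0 := by rintro rfl; simp at hn
  have hcop : IsCoprime (m - l) (m + l) := by
    obtain ⟨x, y, hxy⟩ := hlm
    have h2 : IsCoprime (m - l) 2 := (Int.isCoprime_two_right).2 hodd
    have hl : IsCoprime (m - l) l := ⟨y, x + y, by linear_combination hxy⟩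
    obtain ⟨z, w, hzw⟩ := h2.mul_right hl
    exact ⟨z - w, w, by linear_combination hzw⟩
  have hfac : k * n = (m - l) * (m + l) := by rw [← h₁]; ring
  obtain ⟨α, γ, β, δ, rfl, rfl, hP, hQ⟩ := exists_common_refinement hk0 hfac
  rw [hP, hQ] at hcop
  have hαδ : IsCoprime α δ := hcop.of_mul_left_left.of_mul_right_right
  have hαγ : IsCoprime α γ := hcop.of_mul_left_left.of_mul_right_left
  have hγβ : IsCoprime γ β := hcop.of_mul_left_right.of_mul_right_left.symm
  have hlm4 : 4 * (l * m) = (γ * δ) ^ 2 - (α * β) ^ 2 := by rw [← hP, ← hQ]; ring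
  have hδ0 : δ ≠ 0 := right_ne_zero_of_mul hn0
  obtain ⟨e, he₁, he₂⟩ := exists_eq_mul_sq_of_sq_mul_eq hδ0 hαδ
    (P := 4 * γ ^ 2 + 3 * β ^ 2) (Q := 3 * γ ^ 2 + 4 * β ^ 2)
    (by linear_combination 4 * h₂ + 3 * hlm4)
  have he := eq_of_dvd_seven_mul_sq (e := e) hγβ
    ⟨4 * δ ^ 2 - 3 * α ^ 2, by linear_combination 4 * he₁ - 3 * he₂⟩
    ⟨4 * α ^ 2 - 3 * δ ^ 2, by linear_combination 4 * he₂ - 3 * he₁⟩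
  have hαo := (Int.odd_mul.1 hk).1
  have hγo := (Int.odd_mul.1 hk).2
  have hα := sq_emod_eight_of_odd hαo
  have hγ := sq_emod_eight_of_odd hγo
  have hβ := sq_emod_eight_of_odd (Int.odd_mul.1 hn).1
  have hδ := sq_emod_eight_of_odd (Int.odd_mul.1 hn).2
  obtain rfl : e = 7 := by
    have := sq_nonneg γ
    have := sq_nonneg β
    have := sq_nonneg δ
    rcases he with rfl | rfl | rfl | rfl <;> first | rfl | omega
  obtain ⟨a, ha⟩ : (2 : ℤ) ∣ α + γ := (hαo.add_odd hγo).two_dvd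
  obtain ⟨b, hb⟩ : (2 : ℤ) ∣ α - γ := (hαo.sub_odd hγo).two_dvd
  obtain rfl : α = a + b := by linarith
  obtain rfl : γ = a - b := by linarith
  have hab7 : 7 * (a * b) = β ^ 2 - (a - b) ^ 2 := by linarith
  refine ⟨a, b, δ, β, ?_, ?_, by linarith, by linarith, ?_⟩
  · obtain ⟨x, y, hxy⟩ := hαγ
    exact ⟨x + y, x - y, by linear_combination hxy⟩
  · intro h0
    have h1 : (a + b) ^ 2 = (a - b) ^ 2 := by linear_combination 4 * h0
    have h2 : β ^ 2 = δ ^ 2 := by linarith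
    have : 4 * (l * m) = 0 := by
      rw [hlm4, mul_pow, mul_pow, h1, h2]; ring
    simp [hl0, hm0] at this
  · have hlm1 : 1 ≤ |l * m| := Int.one_le_abs (mul_ne_zero hl0 hm0)
    have hβ1 : 1 ≤ β ^ 2 := by have := sq_nonneg β; omega
    have hγ1 : 1 ≤ (a - b) ^ 2 := by have := sq_nonneg (a - b); omega
    have hαδ' : 4 * |β * (a - b)| ≤ 7 * |(a + b) * δ| := by
      rw [← abs_of_pos (by norm_num : (0 : ℤ) < 4), ← abs_of_pos (by norm_num : (0 : ℤ) < 7),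
        ← abs_mul, ← abs_mul, ← sq_le_sq]
      have e1 : 4 * β ^ 2 ≤ 7 * (a + b) ^ 2 := by linarith
      have e2 : 4 * (a - b) ^ 2 ≤ 7 * δ ^ 2 := by linarith
      nlinarith [mul_le_mul e1 e2 (by positivity) (by positivity)]
    have hkn7 : 4 * (β ^ 2 * (a - b) ^ 2) ≤ 7 * |(a + b) * (a - b) * (β * δ)| := by
      have e1 : |(a + b) * (a - b) * (β * δ)| = |(a + b) * δ| * |β * (a - b)| := by
        rw [← abs_mul]; ring_nf
      have e2 : β ^ 2 * (a - b) ^ 2 = |β * (a - b)| * |β * (a - b)| := by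
        rw [abs_mul_abs_self]; ring
      rw [e1, e2]
      nlinarith [mul_le_mul_of_nonneg_right hαδ' (abs_nonneg (β * (a - b)))]
    have hsplit : |(a + b) * (a - b) * l * m * (β * δ)|
        = |(a + b) * (a - b) * (β * δ)| * |l * m| := by
      rw [← abs_mul]; ring_nf
    have hle : |(a + b) * (a - b) * (β * δ)| ≤ |(a + b) * (a - b) * (β * δ)| * |l * m| :=
      le_mul_of_one_le_right (abs_nonneg _) hlm1
    have hlt : |7 * (a * b)| < 4 * (β ^ 2 * (a - b) ^ 2) := by
      rw [hab7, abs_lt]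
      constructor <;> nlinarith
    rw [abs_mul, abs_of_pos (by norm_num : (0 : ℤ) < 7)] at hlt
    rw [hsplit]
    linarith

/-- Nonzero solutions of the second covering lead to a smaller pair on which both quadratic forms
are squares. -/
theorem second_descent {k l m n : ℤ} (h0 : k * l * m * n ≠ 0)
    (hkn : IsCoprime k n) (hlm : IsCoprime l m)
    (h₁ : m ^ 2 - l ^ 2 = k * n) (h₂ : k ^ 2 - n ^ 2 = 3 * (l * m)) :
    ∃ a b r s : ℤ, IsCoprime a b ∧ a * b ≠ 0 ∧ a ^ 2 + a * b + b ^ 2 = r ^ 2 ∧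
      a ^ 2 + 5 * (a * b) + b ^ 2 = s ^ 2 ∧ |a * b| < |k * l * m * n| := by
  have hn0 : n ≠ 0 := right_ne_zero_of_mul h0
  have hm0 : m ≠ 0 := right_ne_zero_of_mul (left_ne_zero_of_mul h0)
  have hl0 : l ≠ 0 := right_ne_zero_of_mul (left_ne_zero_of_mul (left_ne_zero_of_mul h0))
  have hk0 : k ≠ 0 := left_ne_zero_of_mul (left_ne_zero_of_mul (left_ne_zero_of_mul h0))
  have p₁ := congrArg Even h₁
  have p₂ := congrArg Even h₂
  have not_even {u v : ℤ} (h : IsCoprime u v) : ¬ (Even u ∧ Even v) := fun ⟨hu, hv⟩ => by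
    have := Int.isUnit_iff.1 (h.isUnit_of_dvd' hu.two_dvd hv.two_dvd)
    omega
  have q₁ := not_even hkn
  have q₂ := not_even hlm
  have h3 : ¬ Even (3 : ℤ) := by decide
  simp only [Int.even_sub, Int.even_mul, Int.even_pow' two_ne_zero, h3, false_or, eq_iff_iff]
    at p₁ p₂
  by_cases hk : Even k
  · exact (second_descent_even hk hn0 hkn (Int.not_even_iff_odd.1 (by tauto))
      (Int.not_even_iff_odd.1 (by tauto)) (Int.not_even_iff_odd.1 (by tauto)) h₁ h₂).elim
  by_cases hn : Even n
  · exact (second_descent_even (k := n) (l := l) (m := -m) (n := k) hn hk0 hkn.symm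
      (Int.not_even_iff_odd.1 hk) (Int.not_even_iff_odd.1 (by tauto))
      (Int.not_even_iff_odd.1 (by rw [even_neg]; tauto)) (by linear_combination h₁)
      (by linear_combination -h₂)).elim
  · refine second_descent_odd (Int.not_even_iff_odd.1 hk) (Int.not_even_iff_odd.1 hn) hl0 hm0
      hkn hlm (Int.not_even_iff_odd.1 ?_) h₁ h₂
    rw [Int.even_sub]
    tauto

/-- For coprime `a`, `b`, the two quadratic forms take coprime values, the first one odd. -/
theorem quadratic_forms_coprime {a b : ℤ} (hab : IsCoprime a b) :
    Odd (a ^ 2 + a * b + b ^ 2) ∧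
      IsCoprime (a ^ 2 + a * b + b ^ 2) (a ^ 2 + 5 * (a * b) + b ^ 2) := by
  have hodd : Odd (a ^ 2 + a * b + b ^ 2) := by
    rw [← Int.not_even_iff_odd]
    intro h
    have he : Even a ∧ Even b := by
      simp only [Int.even_add, Int.even_mul, Int.even_pow' two_ne_zero] at h
      tauto
    have := Int.isUnit_iff.1 (hab.isUnit_of_dvd' he.1.two_dvd he.2.two_dvd)
    omega
  refine ⟨hodd, ?_⟩
  have h2 : IsCoprime (a ^ 2 + a * b + b ^ 2) 2 := (Int.isCoprime_two_right).2 hodd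
  have ha : IsCoprime (a ^ 2 + a * b + b ^ 2) a := by
    obtain ⟨x, y, hxy⟩ := hab.pow_right (n := 2)
    exact ⟨y, x - y * (a + b), by linear_combination hxy⟩
  have hb : IsCoprime (a ^ 2 + a * b + b ^ 2) b := by
    obtain ⟨x, y, hxy⟩ := hab.pow_left (m := 2)
    exact ⟨x, y - x * (a + b), by linear_combination hxy⟩
  obtain ⟨x, y, hxy⟩ := ((h2.mul_right h2).mul_right (ha.mul_right hb))
  exact ⟨x - y, y, by linear_combination hxy⟩

/-- A pair on which both quadratic forms are squares leads to a smaller such pair. -/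
theorem first_descent {a b r s : ℤ} (hab : IsCoprime a b) (h0 : a * b ≠ 0)
    (hr : a ^ 2 + a * b + b ^ 2 = r ^ 2) (hs : a ^ 2 + 5 * (a * b) + b ^ 2 = s ^ 2) :
    ∃ a' b' r' s' : ℤ, IsCoprime a' b' ∧ a' * b' ≠ 0 ∧ a' ^ 2 + a' * b' + b' ^ 2 = r' ^ 2 ∧
      a' ^ 2 + 5 * (a' * b') + b' ^ 2 = s' ^ 2 ∧ |a' * b'| < |a * b| := by
  obtain ⟨hodd, hcop⟩ := quadratic_forms_coprime hab
  rw [hr, hs, IsCoprime.pow_iff two_pos two_pos] at hcop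
  have hro : Odd r := by
    rw [hr] at hodd
    exact (Int.odd_pow' two_ne_zero).1 hodd
  have hso : Odd s := by
    rw [← Int.odd_pow' two_ne_zero, ← hs,
      show a ^ 2 + 5 * (a * b) + b ^ 2 = (a ^ 2 + a * b + b ^ 2) + 2 * (2 * (a * b)) by ring]
    exact hodd.add_even (even_two_mul _)
  obtain ⟨p, hp⟩ : (2 : ℤ) ∣ s + r := (hso.add_odd hro).two_dvd
  obtain ⟨q, hq⟩ : (2 : ℤ) ∣ s - r := (hso.sub_odd hro).two_dvd
  obtain rfl : s = p + q := by linarith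
  obtain rfl : r = p - q := by linarith
  have hpq : IsCoprime p q := by
    obtain ⟨x, y, hxy⟩ := hcop
    exact ⟨x + y, y - x, by linear_combination hxy⟩
  have hprod : a * b = p * q := by linarith
  obtain ⟨k, l, m, n, rfl, rfl, rfl, rfl⟩ :=
    exists_common_refinement (left_ne_zero_of_mul h0) hprod
  have hkn : IsCoprime k n := hab.of_mul_left_left.of_mul_right_right
  have hlm : IsCoprime l m := hab.of_mul_left_right.of_mul_right_left
  have hmain : (k ^ 2 - n ^ 2) * (m ^ 2 - l ^ 2) = 3 * (k * l * m * n) := by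
    linear_combination -hr
  have hn0 : k * n ≠ 0 := fun h => h0 (by linear_combination l * m * h)
  have hlm0 : l * m ≠ 0 := fun h => h0 (by linear_combination k * n * h)
  have key : IsCoprime (k * n) (k ^ 2 - n ^ 2) := by
    refine IsCoprime.mul_left ?_ ?_
    · obtain ⟨x, y, hxy⟩ := hkn.pow_right (n := 2)
      exact ⟨x + y * k, -y, by linear_combination hxy⟩
    · obtain ⟨x, y, hxy⟩ := hkn.pow_left (m := 2)
      exact ⟨y + x * n, x, by linear_combination hxy⟩
  have key' : IsCoprime (l * m) (m ^ 2 - l ^ 2) := by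
    refine IsCoprime.mul_left ?_ ?_
    · obtain ⟨x, y, hxy⟩ := hlm.pow_right (n := 2)
      exact ⟨x + y * l, y, by linear_combination hxy⟩
    · obtain ⟨x, y, hxy⟩ := hlm.pow_left (m := 2)
      exact ⟨y + x * m, -x, by linear_combination hxy⟩
  obtain ⟨c, hc⟩ : k * n ∣ m ^ 2 - l ^ 2 :=
    key.dvd_of_dvd_mul_left ⟨3 * (l * m), by linear_combination hmain⟩
  obtain ⟨d, hd⟩ : l * m ∣ k ^ 2 - n ^ 2 :=
    key'.dvd_of_dvd_mul_right ⟨3 * (k * n), by linear_combination hmain⟩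
  have hcd : c * d = 3 := by
    refine mul_left_cancel₀ (mul_ne_zero hn0 hlm0) ?_
    rw [hc, hd] at hmain
    linear_combination hmain
  have h0' : k * l * m * n ≠ 0 := by convert h0 using 1; ring
  have hcases : (c = 1 ∧ d = 3) ∨ (c = 3 ∧ d = 1) ∨ (c = -1 ∧ d = -3) ∨ (c = -3 ∧ d = -1) := by
    have hc3 : c.natAbs ∣ 3 := Int.natAbs_dvd_natAbs.2 (Dvd.intro d hcd)
    rcases (Nat.dvd_prime Nat.prime_three).1 hc3 with h | h <;>
      rcases Int.natAbs_eq c with h' | h' <;> rw [h', h] at hcd ⊢ <;> norm_num at hcd ⊢ <;> omega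
  have habs : |k * l * (m * n)| = |k * l * m * n| := by rw [mul_assoc (k * l)]
  rw [habs]
  rcases hcases with ⟨rfl, rfl⟩ | ⟨rfl, rfl⟩ | ⟨rfl, rfl⟩ | ⟨rfl, rfl⟩
  · exact second_descent h0' hkn hlm (by linear_combination hc) (by linear_combination hd)
  · have := second_descent (k := m) (l := n) (m := k) (n := l)
      (by convert h0' using 1; ring) hlm.symm hkn.symm
      (by linear_combination hd) (by linear_combination hc)
    rwa [show m * n * k * l = k * l * m * n by ring] at this
  · have := second_descent (k := k) (l := l) (m := -m) (n := -n)
      (by convert h0' using 1; ring) hkn.neg_right hlm.neg_right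
      (by linear_combination hc) (by linear_combination hd)
    rwa [show k * l * -m * -n = k * l * m * n by ring] at this
  · have := second_descent (k := m) (l := -n) (m := k) (n := -l)
      (by convert h0' using 1; ring) hlm.symm.neg_right hkn.symm.neg_left
      (by linear_combination hd) (by linear_combination hc)
    rwa [show m * -n * k * -l = k * l * m * n by ring] at this

/-- Both quadratic forms cannot be squares at a coprime pair of nonzero integers. -/
theorem not_both_squares {a b r s : ℤ} (hab : IsCoprime a b) (h0 : a * b ≠ 0)
    (hr : a ^ 2 + a * b + b ^ 2 = r ^ 2) (hs : a ^ 2 + 5 * (a * b) + b ^ 2 = s ^ 2) : False := by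
  induction hN : (a * b).natAbs using Nat.strong_induction_on generalizing a b r s with
  | _ N ih =>
    obtain ⟨a', b', r', s', hab', h0', hr', hs', hlt⟩ := first_descent hab h0 hr hs
    exact ih _ (hN ▸ Int.natAbs_lt_iff_sq_lt.2 (sq_lt_sq.2 hlt)) hab' h0' hr' hs' rfl

/-- The genus one curve `v ^ 2 = (t ^ 2 + t + 1) * (t ^ 2 + 5 * t + 1)` has no rational point with
`t ≠ 0`. -/
theorem not_isSquare_quartic {a b : ℤ} (hab : IsCoprime a b) (h0 : a * b ≠ 0) :
    ¬ IsSquare ((a ^ 2 + a * b + b ^ 2) * (a ^ 2 + 5 * (a * b) + b ^ 2)) := by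
  rintro ⟨z, hz⟩
  rw [← sq] at hz
  have hcop := (quadratic_forms_coprime hab).2
  have hpos : 0 < a ^ 2 + a * b + b ^ 2 := by
    have hb : 0 < b ^ 2 := sq_pos_iff.2 (right_ne_zero_of_mul h0)
    nlinarith [sq_nonneg (2 * a + b)]
  have hnonneg : 0 ≤ a ^ 2 + 5 * (a * b) + b ^ 2 :=
    nonneg_of_mul_nonneg_right (hz ▸ sq_nonneg z) hpos
  have eq_sq {A r : ℤ} (hA : 0 ≤ A) (h : A = r ^ 2 ∨ A = -r ^ 2) : A = r ^ 2 := by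
    have := sq_nonneg r
    omega
  obtain ⟨r, hr⟩ := Int.sq_of_isCoprime hcop hz
  obtain ⟨s, hs⟩ := Int.sq_of_isCoprime hcop.symm ((mul_comm _ _).trans hz)
  exact not_both_squares hab h0 (eq_sq hpos.le hr) (eq_sq hnonneg hs)

/-- The affine rational points of the hyperelliptic model of the modular curve `X₀(315)*`. -/
theorem X0_315_star_affine_rational_points (x y : ℚ) :
    y ^ 2 = x ^ 8 + 6 * x ^ 7 + 11 * x ^ 6 + 24 * x ^ 5 + 21 * x ^ 4
        + 24 * x ^ 3 + 11 * x ^ 2 + 6 * x + 1 ↔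
      (x, y) = (0, 1) ∨ (x, y) = (0, -1) := by
  simp only [Prod.mk.injEq]
  constructor
  · intro h
    by_cases hx : x = 0
    · subst hx
      have : y ^ 2 = 1 := by linarith
      simpa using this
    exfalso
    have hden : (x.den : ℚ) ≠ 0 := by exact_mod_cast x.den_nz
    have hcop : IsCoprime x.num (x.den : ℤ) := by
      rw [Int.isCoprime_iff_nat_coprime]
      exact x.reduced
    have hcop' : IsCoprime (x.num ^ 2 + (x.den : ℤ) ^ 2) (x.num * x.den) := by
      refine IsCoprime.mul_right ?_ ?_
      · obtain ⟨u, v, huv⟩ := hcop.pow_right (n := 2)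
        exact ⟨v, u - v * x.num, by linear_combination huv⟩
      · obtain ⟨u, v, huv⟩ := hcop.pow_left (m := 2)
        exact ⟨u, v - u * x.den, by linear_combination huv⟩
    have hne : (x.num ^ 2 + (x.den : ℤ) ^ 2) * (x.num * x.den) ≠ 0 := by
      have hn : x.num ≠ 0 := Rat.num_ne_zero.2 hx
      have hd : (x.den : ℤ) ≠ 0 := by exact_mod_cast x.den_nz
      positivity
    refine not_isSquare_quartic hcop' hne (Rat.isSquare_intCast_iff.1 ⟨y * x.den ^ 4, ?_⟩)
    have hnum : (x.num : ℚ) = x * x.den := (Rat.mul_den_eq_num x).symm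
    push_cast
    rw [hnum]
    linear_combination -(x.den : ℚ) ^ 8 * h
  · rintro (⟨rfl, rfl⟩ | ⟨rfl, rfl⟩) <;> norm_num
end

section
/- The only pairs (x, y) of rational numbers satisfying y^2 = x(x^3 - 2x^2 + 2)(x^3 - 4x + 4)(x^3 + 2x^2 - 2) are (0, 0), (1, 1), and (1, -1). -/
theorem exists_squarefree_mul_sq {R : Type*} [CommRing R] [IsDomain R]
    [UniqueFactorizationMonoid R] {x : R} (hx : x ≠ 0) :
    ∃ k g : R, x = k * g ^ 2 ∧ Squarefree k := by
  induction x using UniqueFactorizationMonoid.induction_on_prime with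
  | h₁ => exact absurd rfl hx
  | h₂ x h => exact ⟨x, 1, by simp, h.squarefree⟩
  | h₃ a p ha hp ih =>
    obtain ⟨k, g, rfl, hk⟩ := ih ha
    by_cases hd : p ∣ k
    · obtain ⟨l, rfl⟩ := hd
      exact ⟨l, p * g, by ring, hk.of_mul_right⟩
    · refine ⟨p * k, g, by ring, squarefree_mul_iff.2 ⟨?_, hp.irreducible.squarefree, hk⟩⟩
      exact (hp.irreducible.isRelPrime_iff_not_dvd).2 hd

/-- If a product is a unit times a square, then a prime dividing the squarefree part of one factor
divides the other factor. -/
theorem Prime.dvd_of_dvd_squarefree {R : Type*} [CommRing R] [IsDomain R]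
    [UniqueFactorizationMonoid R] {k g a d z p : R} (hp : Prime p) (hk : Squarefree k)
    (hg : g ≠ 0) (hd : IsUnit d) (h : k * g ^ 2 * a = d * z ^ 2) (hpk : p ∣ k) : p ∣ a := by
  by_contra hpa
  have h1 : g ^ 2 ∣ z ^ 2 := by
    rw [← hd.dvd_mul_left (a := g ^ 2), ← h]
    exact ⟨k * a, by ring⟩
  obtain ⟨w, rfl⟩ := (UniqueFactorizationMonoid.pow_dvd_pow_iff_dvd two_ne_zero).1 h1
  have h2 : k * a = d * w ^ 2 := by
    apply mul_left_cancel₀ (pow_ne_zero 2 hg)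
    linear_combination h
  have h3 : p ∣ w := by
    apply hp.dvd_of_dvd_pow (n := 2)
    rw [← hd.dvd_mul_left, ← h2]
    exact hpk.mul_right a
  have h4 : p ^ 2 ∣ k * a := h2 ▸ (pow_dvd_pow_of_dvd h3 2).mul_left d
  have h5 := hp.pow_dvd_of_dvd_mul_right 2 hpa h4
  exact hp.not_isUnit (hk p (by rwa [← sq]))

theorem exists_sq_of_isCoprime_of_mul_eq_sq {a f y : ℤ} (ha : 0 < a) (h : IsCoprime a f)
    (hy : a * f = y ^ 2) : ∃ s z : ℤ, s ≠ 0 ∧ a = s ^ 2 ∧ f = z ^ 2 := by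
  obtain ⟨s, hs | hs⟩ := Int.sq_of_isCoprime h hy
  · have hs0 : s ≠ 0 := by rintro rfl; simp at hs; omega
    have : s ∣ y := by
      rw [← Int.pow_dvd_pow_iff two_ne_zero, ← hy, hs]
      exact dvd_mul_right _ _
    obtain ⟨z, rfl⟩ := this
    refine ⟨s, z, hs0, hs, mul_left_cancel₀ (pow_ne_zero 2 hs0) ?_⟩
    rw [← hs, hy, hs]; ring
  · nlinarith [sq_nonneg s]

theorem Rat.exists_int_eq_of_sq_eq {y : ℚ} {n : ℤ} (h : y ^ 2 = n) : ∃ m : ℤ, y = m := by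
  have : IsIntegral ℤ y := by
    refine ⟨Polynomial.X ^ 2 - Polynomial.C n, Polynomial.monic_X_pow_sub_C n two_ne_zero, ?_⟩
    rw [Polynomial.eval₂_sub, Polynomial.eval₂_pow, Polynomial.eval₂_X, Polynomial.eval₂_C, h]
    simp
  obtain ⟨m, hm⟩ := IsIntegrallyClosed.isIntegral_iff.1 this
  exact ⟨m, by simpa using hm.symm⟩

theorem cube_sub_ne_zero {a b : ℤ} (h : IsCoprime a b) :
    a ^ 3 - 4 * a * b ^ 2 + 4 * b ^ 3 ≠ 0 := by
  intro h0
  have ha : 2 ∣ a := Int.prime_two.dvd_of_dvd_pow (n := 3) ⟨2 * a * b ^ 2 - 2 * b ^ 3, by linarith⟩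
  obtain ⟨c, rfl⟩ := ha
  have hb : 2 ∣ b := Int.prime_two.dvd_of_dvd_pow (n := 3) ⟨c * b ^ 2 - c ^ 3, by linarith⟩
  exact absurd (h.isUnit_of_dvd' (dvd_mul_right 2 c) hb) (by decide)

theorem exists_sq_of_mul_cubic_eq_sq {a b d y : ℤ} (ha : 0 < a) (hab : IsCoprime a b)
    (hd : d = 1 ∨ d = -1) (h : a * (d * (a ^ 3 - 4 * a * b ^ 2 + 4 * b ^ 3)) = y ^ 2) :
    ∃ s z : ℤ, s ≠ 0 ∧ z ≠ 0 ∧ a = s ^ 2 ∧ a ^ 3 - 4 * a * b ^ 2 + 4 * b ^ 3 = d * z ^ 2 := by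
  have hdu : IsUnit d := Int.isUnit_iff.2 hd
  have hdd : d * d = 1 := by rcases hd with rfl | rfl <;> rfl
  suffices ∃ s z : ℤ, s ≠ 0 ∧ a = s ^ 2 ∧ d * (a ^ 3 - 4 * a * b ^ 2 + 4 * b ^ 3) = z ^ 2 by
    obtain ⟨s, z, hs, has, hz⟩ := this
    refine ⟨s, z, hs, ?_, has, by rw [← hz, ← mul_assoc, hdd, one_mul]⟩
    rintro rfl
    simp only [ne_eq, OfNat.ofNat_ne_zero, not_false_eq_true, zero_pow, mul_eq_zero] at hz
    exact hz.elim hdu.ne_zero (cube_sub_ne_zero hab)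
  obtain ⟨c, rfl | rfl⟩ := Int.even_or_odd' a
  · obtain ⟨w, rfl⟩ : (4 : ℤ) ∣ y := by
      have h2 : (2 : ℤ) ∣ y := Int.prime_two.dvd_of_dvd_pow (n := 2)
        (h ▸ (dvd_mul_right 2 c).mul_right _)
      obtain ⟨y, rfl⟩ := h2
      refine (mul_dvd_mul_left 2 (Int.prime_two.dvd_of_dvd_pow (n := 2)
        ⟨c * (d * (2 * c ^ 3 - 2 * c * b ^ 2 + b ^ 3)), ?_⟩) : (2 * 2 : ℤ) ∣ 2 * y)
      linarith
    have hb : Odd b := by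
      rw [← Int.not_even_iff_odd, even_iff_two_dvd]
      exact fun hb => absurd (hab.isUnit_of_dvd' (dvd_mul_right 2 c) hb) (by decide)
    set G := 2 * c ^ 3 - 2 * c * b ^ 2 + b ^ 3 with hG
    have h1 : c * (d * G) = 2 * w ^ 2 := by linarith
    have hGo : ¬ 2 ∣ G := by
      rw [← even_iff_two_dvd, Int.not_even_iff_odd, hG]
      exact Even.add_odd ⟨c ^ 3 - c * b ^ 2, by ring⟩ hb.pow
    obtain ⟨e, rfl⟩ : 2 ∣ c := by
      have := (Int.prime_two.dvd_or_dvd ⟨_, h1⟩).resolve_right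
      rw [hdu.dvd_mul_left] at this
      exact this hGo
    have hcop : IsCoprime e (d * G) := by
      rw [isCoprime_mul_unit_left_right hdu]
      have h2 : IsCoprime e (b ^ 3) := IsCoprime.pow_right
        (hab.of_isCoprime_of_dvd_left ⟨4, by ring⟩)
      rw [show G = b ^ 3 + e * (16 * e ^ 2 - 4 * b ^ 2) by rw [hG]; ring]
      exact h2.add_mul_left_right _
    obtain ⟨s, z, hs, rfl, hz⟩ := exists_sq_of_isCoprime_of_mul_eq_sq (y := w) (by omega) hcop
      (by linarith)
    exact ⟨2 * s, 2 * z, by simpa using hs, by ring, by linear_combination 4 * hz⟩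
  · have hcop : IsCoprime (2 * c + 1) (d * ((2 * c + 1) ^ 3 - 4 * (2 * c + 1) * b ^ 2 +
        4 * b ^ 3)) := by
      rw [isCoprime_mul_unit_left_right hdu]
      have h4 : IsCoprime (2 * c + 1) 4 := by
        rw [show (4 : ℤ) = 2 ^ 2 by rfl]
        exact IsCoprime.pow_right ⟨1, -c, by ring⟩
      rw [show (2 * c + 1) ^ 3 - 4 * (2 * c + 1) * b ^ 2 + 4 * b ^ 3 =
        4 * b ^ 3 + (2 * c + 1) * ((2 * c + 1) ^ 2 - 4 * b ^ 2) by ring]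
      exact (h4.mul_right hab.pow_right).add_mul_left_right _
    exact exists_sq_of_isCoprime_of_mul_eq_sq ha hcop h

theorem le_three_of_duplication_le {A B M : ℤ} (hA : 0 < A) (hM : M = max |B| A)
    (hn : |B ^ 4 - 2 * B * A ^ 3 + A ^ 4| ≤ 11 * M)
    (hD : |A * (4 * B ^ 3 - 4 * B ^ 2 * A + A ^ 3)| ≤ 11 * M) : A ≤ 3 ∧ |B| ≤ 3 := by
  have key {M c : ℤ} (hM : 0 < M) (hc : M ^ 4 ≤ c * M) (hc' : c < 64) : M ≤ 3 := by
    by_contra! h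
    have : M ^ 3 ≤ c := by nlinarith
    nlinarith [mul_self_nonneg (M - 4)]
  rw [abs_le] at hn hD
  rcases le_total |B| A with h | h
  · rw [max_eq_right h] at hM
    subst hM
    suffices M ≤ 3 from ⟨this, h.trans this⟩
    rcases le_total 0 B with hB | hB
    · refine key (c := 27) hA ?_ (by norm_num)
      have : 0 ≤ M * ((3 * B - 2 * M) ^ 2 * (3 * B + M)) := by positivity
      nlinarith
    · refine key (c := 11) hA ?_ (by norm_num)
      have : 0 ≤ (-B) * M ^ 3 := mul_nonneg (by omega) (by positivity)
      nlinarith [pow_nonneg (sq_nonneg B) 2]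
  · rw [max_eq_left h] at hM
    suffices M ≤ 3 by omega
    have hM0 : 0 < M := by omega
    refine key (c := 22) hM0 ?_ (by norm_num)
    rcases le_total 0 B with hB | hB
    · rw [abs_of_nonneg hB] at hM h
      subst hM
      have : 0 ≤ A * (4 * M ^ 2 - 2 * A ^ 2) * (M - A) := by
        apply mul_nonneg (mul_nonneg hA.le _) (by omega)
        nlinarith
      nlinarith
    · rw [abs_of_nonpos hB] at hM h
      obtain rfl : B = -M := by omega
      have : 0 ≤ M * A ^ 3 := by positivity
      have : 0 ≤ A ^ 4 := by positivity
      nlinarith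

section CubicField

open Polynomial NumberField

/-- The polynomial `X ^ 3 - 2 * X ^ 2 + 2`, irreducible over `ℚ`. -/
noncomputable def tribPoly : ℚ[X] := X ^ 3 - 2 * X ^ 2 + 2

theorem tribPoly_natDegree : tribPoly.natDegree = 3 := by
  unfold tribPoly; compute_degree!

theorem tribPoly_irreducible : Irreducible tribPoly := by
  have hm : (X ^ 3 - 2 * X ^ 2 + 2 : ℤ[X]).Monic := by monicity!
  have hd : (X ^ 3 - 2 * X ^ 2 + 2 : ℤ[X]).natDegree = 3 := by compute_degree!
  have h : (X ^ 3 - 2 * X ^ 2 + 2 : ℤ[X]).IsEisensteinAt (Ideal.span {2}) := by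
    refine hm.isEisensteinAt_of_mem_of_notMem ?_ ?_ ?_
    · rw [Ne, Ideal.span_singleton_eq_top, Int.isUnit_iff]; norm_num
    · intro n hn
      rw [hd] at hn
      rw [Ideal.mem_span_singleton]
      interval_cases n <;> simp [coeff_ofNat_mul, coeff_X_pow]
    · rw [Ideal.span_singleton_pow, Ideal.mem_span_singleton]
      simp [coeff_ofNat_mul, coeff_X_pow]
  have hp : (Ideal.span {(2 : ℤ)}).IsPrime :=
    (Ideal.span_singleton_prime two_ne_zero).2 Int.prime_two
  have := h.irreducible hp hm.isPrimitive (by rw [hd]; norm_num)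
  rw [hm.irreducible_iff_irreducible_map_fraction_map (K := ℚ)] at this
  convert this using 1
  simp [tribPoly]

instance : Fact (Irreducible tribPoly) := ⟨tribPoly_irreducible⟩

/-- The cubic field of discriminant `-44`. -/
def TribField : Type := AdjoinRoot tribPoly

noncomputable instance : Field TribField := inferInstanceAs (Field (AdjoinRoot tribPoly))

namespace TribField

noncomputable section

/-- A root of `tribPoly`. -/
def ϖ : TribField := AdjoinRoot.root tribPoly

theorem ϖ_cube : ϖ ^ 3 = 2 * ϖ ^ 2 - 2 := by
  have h : eval₂ (AdjoinRoot.of tribPoly) (AdjoinRoot.root tribPoly) tribPoly = 0 :=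
    AdjoinRoot.eval₂_root tribPoly
  conv at h => enter [1, 3]; unfold tribPoly
  simp only [eval₂_add, eval₂_sub, eval₂_mul, eval₂_pow, eval₂_X, eval₂_ofNat] at h
  have h' : ϖ ^ 3 - 2 * ϖ ^ 2 + 2 = 0 := h
  linear_combination h'

instance : CharZero TribField := inferInstanceAs (CharZero (AdjoinRoot tribPoly))

/-- The power basis `1, ϖ, ϖ ^ 2`. -/
def basis : Module.Basis (Fin 3) ℚ TribField :=
  ((AdjoinRoot.powerBasis tribPoly_irreducible.ne_zero).basis.reindex
    (finCongr (by simp [tribPoly_natDegree]))).map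
      (LinearEquiv.ofBijective
        (AddMonoidHom.toRatLinearMap (AddMonoidHom.id (AdjoinRoot tribPoly) :
          AdjoinRoot tribPoly →+ TribField)) Function.bijective_id)

theorem basis_apply (i : Fin 3) : basis i = ϖ ^ (i : ℕ) := by
  have h : (AdjoinRoot.powerBasis tribPoly_irreducible.ne_zero).basis
      ((finCongr (by simp [tribPoly_natDegree])).symm i) = AdjoinRoot.root tribPoly ^ (i : ℕ) := by
    rw [PowerBasis.basis_eq_pow]; rfl
  rw [← Module.Basis.reindex_apply] at h
  exact h

instance : NumberField TribField where
  to_finiteDimensional := Module.Finite.of_basis basis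

theorem finrank_eq : Module.finrank ℚ TribField = 3 := by
  simp [Module.finrank_eq_card_basis basis]

theorem exists_rep (x : TribField) : ∃ p q r : ℚ, x = p + q * ϖ + r * ϖ ^ 2 := by
  refine ⟨basis.repr x 0, basis.repr x 1, basis.repr x 2, ?_⟩
  conv_lhs => rw [← basis.sum_repr x]
  simp [Fin.sum_univ_three, basis_apply, Algebra.smul_def]

theorem rep_eq_zero {p q r : ℚ} (h : (p + q * ϖ + r * ϖ ^ 2 : TribField) = 0) :
    p = 0 ∧ q = 0 ∧ r = 0 := by
  have := Fintype.linearIndependent_iff.1 basis.linearIndependent ![p, q, r]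
    (by simpa [Fin.sum_univ_three, basis_apply, Algebra.smul_def] using h)
  exact ⟨this 0, this 1, this 2⟩

/-- The matrix of multiplication by `p + q * ϖ + r * ϖ ^ 2` in the power basis. -/
def mulMatrix (p q r : ℚ) : Matrix (Fin 3) (Fin 3) ℚ :=
  !![p, -2 * r, -2 * q - 4 * r; q, p, -2 * r; r, q + 2 * r, p + 2 * q + 4 * r]

theorem leftMulMatrix_eq (p q r : ℚ) :
    Algebra.leftMulMatrix basis (p + q * ϖ + r * ϖ ^ 2) = mulMatrix p q r := by
  have key (j : Fin 3) : (p + q * ϖ + r * ϖ ^ 2) * basis j =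
      ∑ i, mulMatrix p q r i j • basis i := by
    fin_cases j <;>
      simp [mulMatrix, Fin.sum_univ_three, basis_apply, Algebra.smul_def]
    · linear_combination r * ϖ_cube
    · linear_combination (q + r * ϖ + 2 * r) * ϖ_cube
  ext i j
  rw [Algebra.leftMulMatrix_eq_repr_mul, key, basis.repr_sum_self]

theorem norm_eq (p q r : ℚ) : Algebra.norm ℚ (p + q * ϖ + r * ϖ ^ 2 : TribField) =
    p ^ 3 - 2 * q ^ 3 + 4 * r ^ 3 + 2 * p ^ 2 * q + 4 * p ^ 2 * r + 8 * p * r ^ 2 + 6 * p * q * r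
      - 4 * q ^ 2 * r := by
  rw [Algebra.norm_eq_matrix_det basis, leftMulMatrix_eq]
  simp [mulMatrix, Matrix.det_fin_three]
  ring

theorem trace_eq (p q r : ℚ) : Algebra.trace ℚ TribField (p + q * ϖ + r * ϖ ^ 2 : TribField) =
    3 * p + 2 * q + 4 * r := by
  rw [Algebra.trace_eq_matrix_trace basis, leftMulMatrix_eq]
  simp [mulMatrix, Matrix.trace_fin_three]
  ring

theorem discr_basis : Algebra.discr ℚ basis = -44 := by
  have h (p q r : ℚ) (x : TribField) (hx : x = p + q * ϖ + r * ϖ ^ 2) :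
      Algebra.trace ℚ TribField x = 3 * p + 2 * q + 4 * r := by rw [hx, trace_eq]
  have h0 := h 1 0 0 1 (by simp)
  have h1 := h 0 1 0 ϖ (by simp)
  have h2 := h 0 0 1 (ϖ ^ 2) (by simp)
  have h3 := h (-2) 0 2 (ϖ ^ 3) (by rw [ϖ_cube]; push_cast; ring)
  have h4 := h (-4) (-2) 4 (ϖ ^ 4) (by push_cast; linear_combination (ϖ + 2) * ϖ_cube)
  rw [Algebra.discr_def, Matrix.det_fin_three]
  simp only [Algebra.traceMatrix_apply, Algebra.traceForm_apply, basis_apply, ← pow_add]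
  simp [h0, h1, h2, h3, h4]
  norm_num

theorem isIntegral_ϖ : IsIntegral ℤ ϖ :=
  ⟨X ^ 3 - 2 * X ^ 2 + 2, by monicity!, by simp [ϖ_cube]⟩

theorem exists_sq_mul_discr : ∃ k : ℤ, k ^ 2 * discr TribField = -44 := by
  let b : Fin 3 → 𝓞 TribField := fun i => ⟨basis i, by rw [basis_apply]; exact isIntegral_ϖ.pow _⟩
  let e : Fin 3 ≃ Module.Free.ChooseBasisIndex ℤ (𝓞 TribField) := Fintype.equivOfCardEq (by
    rw [← Module.finrank_eq_card_chooseBasisIndex, RingOfIntegers.rank, finrank_eq,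
      Fintype.card_fin])
  let B := (RingOfIntegers.basis TribField).reindex e.symm
  refine ⟨(B.toMatrix b).det, ?_⟩
  rw [← discr_eq_discr TribField B]
  have h1 := Algebra.discr_of_matrix_vecMul B (B.toMatrix b)
  have h2 : Matrix.vecMul B ((B.toMatrix b).map (algebraMap ℤ (𝓞 TribField))) = b :=
    Module.Basis.toMatrix_map_vecMul B b
  rw [← h1, h2]
  have h3 : Algebra.discr ℚ basis = ((Algebra.discr ℤ b : ℤ) : ℚ) := by
    rw [Algebra.discr_def, Algebra.discr_def, Int.cast_det]
    congr 1
    ext i j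
    simp only [Algebra.traceMatrix_apply, Algebra.traceForm_apply, Matrix.map_apply,
      Algebra.coe_trace_int]
    rfl
  rw [discr_basis] at h3
  exact_mod_cast h3.symm

theorem discr_bounds : -44 ≤ discr TribField ∧ discr TribField < 0 := by
  obtain ⟨k, hk⟩ := exists_sq_mul_discr
  have h0 : k ≠ 0 := by rintro rfl; simp at hk
  have h1 : 0 < k ^ 2 := by positivity
  constructor <;> nlinarith

theorem nrComplexPlaces_eq : InfinitePlace.nrComplexPlaces TribField = 1 := by
  have h := InfinitePlace.card_add_two_mul_card_eq_rank TribField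
  have h2 := sign_discr TribField
  rw [Int.sign_eq_neg_one_of_neg discr_bounds.2] at h2
  rw [finrank_eq] at h
  have h3 : InfinitePlace.nrComplexPlaces TribField ≤ 1 := by omega
  interval_cases h4 : InfinitePlace.nrComplexPlaces TribField
  · simp at h2
  · rfl

theorem rank_eq : Units.rank TribField = 1 := by
  have h := InfinitePlace.card_add_two_mul_card_eq_rank TribField
  rw [finrank_eq, nrComplexPlaces_eq] at h
  rw [Units.rank, InfinitePlace.card_eq_nrRealPlaces_add_nrComplexPlaces, nrComplexPlaces_eq]
  omega

instance : IsPrincipalIdealRing (𝓞 TribField) := by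
  apply RingOfIntegers.isPrincipalIdealRing_of_abs_discr_lt
  rw [nrComplexPlaces_eq, finrank_eq, abs_of_neg discr_bounds.2]
  have h : -(discr TribField : ℝ) ≤ 44 := by exact_mod_cast neg_le.1 discr_bounds.1
  have := Real.pi_gt_d2
  norm_num [Nat.factorial]
  nlinarith

/-- The prime above `2`. -/
def varpi : 𝓞 TribField := ⟨ϖ, isIntegral_ϖ⟩

theorem coe_varpi : (varpi : TribField) = ϖ := rfl

theorem varpi_cube : varpi ^ 3 = 2 * varpi ^ 2 - 2 := by
  apply RingOfIntegers.ext
  have h2 : ((2 : 𝓞 TribField) : TribField) = 2 := map_ofNat (algebraMap (𝓞 TribField) TribField) 2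
  simp only [map_sub, map_mul, map_pow, coe_varpi, h2, ϖ_cube]

theorem norm_int_eq (p q r : ℤ) : Algebra.norm ℤ (p + q * varpi + r * varpi ^ 2 : 𝓞 TribField) =
    p ^ 3 - 2 * q ^ 3 + 4 * r ^ 3 + 2 * p ^ 2 * q + 4 * p ^ 2 * r + 8 * p * r ^ 2 + 6 * p * q * r
      - 4 * q ^ 2 * r := by
  have h := Algebra.coe_norm_int (p + q * varpi + r * varpi ^ 2 : 𝓞 TribField)
  have h2 := norm_eq p q r
  simp only [map_add, map_mul, map_pow, map_intCast, coe_varpi] at h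
  push_cast at h2
  rw [h2] at h
  exact_mod_cast h

theorem norm_varpi : Algebra.norm ℤ varpi = -2 := by
  simpa using norm_int_eq 0 1 0

theorem isUnit_iff_natAbs_norm {x : 𝓞 TribField} :
    IsUnit x ↔ (Algebra.norm ℤ x).natAbs = 1 := by
  rw [NumberField.isUnit_iff_norm, RingOfIntegers.coe_norm, ← Algebra.coe_norm_int, ← Int.cast_abs]
  rw [← Int.cast_one, Int.cast_inj, Int.abs_eq_natAbs]
  norm_cast

theorem prime_of_prime_norm {x : 𝓞 TribField} (h : (Algebra.norm ℤ x).natAbs.Prime) : Prime x := by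
  rw [← irreducible_iff_prime]
  refine ⟨fun hx => ?_, fun a b hab => ?_⟩
  · rw [isUnit_iff_natAbs_norm.1 hx] at h
    exact Nat.not_prime_one h
  · rw [hab, map_mul, Int.natAbs_mul] at h
    rw [isUnit_iff_natAbs_norm, isUnit_iff_natAbs_norm]
    exact (Nat.prime_mul_iff.1 h).elim (fun h => .inr h.2) (fun h => .inl h.2)

theorem prime_varpi : Prime varpi :=
  prime_of_prime_norm (by rw [norm_varpi]; decide)

theorem varpi_dvd_or_dvd_sub_one (x : 𝓞 TribField) : varpi ∣ x ∨ varpi ∣ x - 1 := by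
  have h : Nat.card (𝓞 TribField ⧸ Ideal.span {varpi}) = 2 := by
    have := Ideal.absNorm_span_singleton varpi
    rw [norm_varpi, Ideal.absNorm_apply] at this
    exact this
  obtain ⟨y, -, hy⟩ := (Nat.card_eq_two_iff' (0 : 𝓞 TribField ⧸ Ideal.span {varpi})).1 h
  rw [← Ideal.Quotient.eq_zero_iff_dvd, ← Ideal.Quotient.eq_zero_iff_dvd, map_sub, map_one,
    sub_eq_zero]
  have : Nontrivial (𝓞 TribField ⧸ Ideal.span {varpi}) := by
    have : Finite (𝓞 TribField ⧸ Ideal.span {varpi}) := Nat.finite_of_card_ne_zero (by omega)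
    exact Finite.one_lt_card_iff_nontrivial.1 (by omega)
  refine or_iff_not_imp_left.2 fun hx => (hy _ hx).trans (hy _ one_ne_zero).symm

/-- A unit which together with `-1` generates the units modulo squares. -/
def tau : 𝓞 TribField := 1 - varpi

theorem isUnit_tau : IsUnit tau := by
  rw [isUnit_iff_natAbs_norm]
  have := norm_int_eq 1 (-1) 0
  simp [← sub_eq_add_neg] at this
  simp [tau, this]

theorem two_eq : (2 : 𝓞 TribField) = -varpi ^ 3 * tau ^ 2 := by
  rw [tau]; linear_combination (1 + varpi ^ 2) * varpi_cube

theorem sq_dvd_two : varpi ^ 2 ∣ 2 := ⟨-varpi * tau ^ 2, by rw [two_eq]; ring⟩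

theorem sq_dvd_sq_sub_one {g : 𝓞 TribField} (h : ¬ varpi ∣ g) : varpi ^ 2 ∣ g ^ 2 - 1 := by
  obtain ⟨c, hc⟩ := (varpi_dvd_or_dvd_sub_one g).resolve_left h
  obtain ⟨d, hd⟩ := sq_dvd_two
  exact ⟨c ^ 2 + varpi * c * d, by linear_combination (g + 1 + varpi * c) * hc + varpi * c * hd⟩

theorem ne_tau_mul_sq {x g σ : 𝓞 TribField} (hx : varpi ^ 2 ∣ x - 1) (hσ : σ = 1 ∨ σ = -1) :
    x ≠ σ * tau * g ^ 2 := by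
  intro h
  have h1 : ¬ varpi ∣ x := fun hd => prime_varpi.not_dvd_one
    ((dvd_sub_right hd).1 ((dvd_pow_self _ two_ne_zero).trans hx))
  have h2 : ¬ varpi ∣ g := fun hd => h1 (h ▸ (hd.trans (dvd_pow_self _ two_ne_zero)).mul_left _)
  have hσ' : varpi ^ 2 ∣ σ - 1 := by
    rcases hσ with rfl | rfl
    · simp
    · rw [show (-1 - 1 : 𝓞 TribField) = -2 by ring, dvd_neg]; exact sq_dvd_two
  have h3 : varpi ^ 2 ∣ varpi * 1 := by
    have e : varpi * 1 = (σ - 1) * tau * g ^ 2 + tau * (g ^ 2 - 1) - (x - 1) := by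
      rw [h, tau]; ring
    rw [e]
    exact dvd_sub (dvd_add ((hσ'.mul_right _).mul_right _)
      ((sq_dvd_sq_sub_one h2).mul_left _)) hx
  rw [sq, mul_dvd_mul_iff_left prime_varpi.ne_zero] at h3
  exact prime_varpi.not_dvd_one h3

theorem unit_eq (u : (𝓞 TribField)ˣ) : ∃ (g σ : 𝓞 TribField), (σ = 1 ∨ σ = -1) ∧
    ((u : 𝓞 TribField) = σ * g ^ 2 ∨ (u : 𝓞 TribField) = σ * tau * g ^ 2) := by
  have hodd : Odd (Module.finrank ℚ TribField) := by rw [finrank_eq]; decide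
  have huniq : Unique (Fin (Units.rank TribField)) := by rw [rank_eq]; infer_instance
  set η := Units.fundSystem TribField default
  have key (x : (𝓞 TribField)ˣ) : ∃ n : ℤ, x = η ^ n ∨ x = -η ^ n := by
    obtain ⟨⟨ζ, e⟩, h, -⟩ := Units.exist_unique_eq_mul_prod TribField x
    refine ⟨e default, ?_⟩
    simp only [Fintype.prod_unique] at h
    rcases Units.torsion_eq_one_or_neg_one_of_odd_finrank hodd ζ with h1 | h1
    · left; simpa [h1] using h
    · right; simpa [h1] using h
  have key2 (x : (𝓞 TribField)ˣ) : ∃ (w σ : (𝓞 TribField)ˣ), (σ = 1 ∨ σ = -1) ∧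
      (x = σ * w ^ 2 ∨ x = σ * η * w ^ 2) := by
    obtain ⟨n, hn⟩ := key x
    obtain ⟨m, rfl | rfl⟩ := Int.even_or_odd' n
    · rw [mul_comm, zpow_mul] at hn
      rcases hn with hn | hn
      · exact ⟨η ^ m, 1, .inl rfl, .inl (by simpa using hn)⟩
      · exact ⟨η ^ m, -1, .inr rfl, .inl (by simpa using hn)⟩
    · rw [zpow_add, mul_comm 2, zpow_mul, zpow_one] at hn
      rcases hn with hn | hn
      · exact ⟨η ^ m, 1, .inl rfl, .inr (by simpa [mul_comm] using hn)⟩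
      · exact ⟨η ^ m, -1, .inr rfl, .inr (by simpa [mul_comm] using hn)⟩
  have hsign {σ : (𝓞 TribField)ˣ} (h : σ = 1 ∨ σ = -1) :
      (σ : 𝓞 TribField) = 1 ∨ (σ : 𝓞 TribField) = -1 := by
    rcases h with rfl | rfl <;> simp
  have hmul {a b : (𝓞 TribField)ˣ} (ha : a = 1 ∨ a = -1) (hb : b = 1 ∨ b = -1) :
      a * b = 1 ∨ a * b = -1 := by
    rcases ha with rfl | rfl <;> rcases hb with rfl | rfl <;> simp
  obtain ⟨t, ht⟩ := isUnit_tau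
  obtain ⟨w, σ, hσ, h | h⟩ := key2 u
  · exact ⟨w, σ, hsign hσ, .inl (by rw [h]; simp)⟩
  obtain ⟨w', σ', hσ', h' | h'⟩ := key2 t
  · exfalso
    refine ne_tau_mul_sq (x := 1) (g := (w'⁻¹ : (𝓞 TribField)ˣ)) (by simp) (hsign hσ') ?_
    rw [← ht, ← Units.val_pow_eq_pow_val, ← Units.val_mul, ← Units.val_mul, ← Units.val_one,
      Units.val_inj, h']
    rcases hσ' with rfl | rfl <;> simp
  · refine ⟨(w * w'⁻¹ : (𝓞 TribField)ˣ), (σ * σ' : (𝓞 TribField)ˣ), hsign (hmul hσ hσ'), .inr ?_⟩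
    rw [← ht, ← Units.val_pow_eq_pow_val, ← Units.val_mul, ← Units.val_mul, Units.val_inj, h, h']
    have h1 : σ' * σ' = 1 := by rcases hσ' with rfl | rfl <;> simp
    have h2 : σ * σ' * (σ' * η * w' ^ 2) * (w * w'⁻¹) ^ 2 =
        σ * (σ' * σ') * η * w ^ 2 * (w' ^ 2 * (w' ^ 2)⁻¹) := by
      rw [mul_pow, inv_pow]; ac_rfl
    rw [h2, h1, mul_inv_cancel, mul_one, mul_one]

/-- A root of `X ^ 3 - 4 * X + 4`. -/
def theta : 𝓞 TribField := 2 * varpi - varpi ^ 2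

/-- The ramified prime above `11`. -/
def rho : 𝓞 TribField := 2 * theta - 3

theorem theta_cube : theta ^ 3 = 4 * theta - 4 := by
  rw [theta]
  linear_combination (- varpi ^ 3 + 4 * varpi ^ 2 - 4 * varpi + 2) * varpi_cube

theorem norm_rho : Algebra.norm ℤ rho = -11 := by
  have h : rho = (-3 : ℤ) + (4 : ℤ) * varpi + (-2 : ℤ) * varpi ^ 2 := by
    rw [rho, theta]; push_cast; ring
  rw [h, norm_int_eq]; norm_num

theorem prime_rho : Prime rho :=
  prime_of_prime_norm (by rw [norm_rho]; norm_num)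

theorem norm_sub_theta_mul (a b : ℤ) :
    Algebra.norm ℤ (a - theta * b : 𝓞 TribField) = a ^ 3 - 4 * a * b ^ 2 + 4 * b ^ 3 := by
  have h : (a - theta * b : 𝓞 TribField) = a + (-2 * b : ℤ) * varpi + b * varpi ^ 2 := by
    rw [theta]; push_cast; ring
  rw [h, norm_int_eq]; ring

theorem three_mul_theta_sq_sub_four : 3 * theta ^ 2 - 4 = 2 * varpi * rho := by
  rw [rho, theta]
  linear_combination (3 * varpi - 2) * varpi_cube

theorem theta_eq : theta = -varpi ^ 2 * tau ^ 2 := by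
  rw [theta, tau]; linear_combination (varpi) * varpi_cube

theorem not_dvd_of_isCoprime {p : 𝓞 TribField} (hp : Prime p) {a b : ℤ} (h : IsCoprime a b)
    (ha : p ∣ a) : ¬ p ∣ b := by
  intro hb
  obtain ⟨u, v, huv⟩ := h
  apply hp.not_dvd_one
  have : (1 : 𝓞 TribField) = u * a + v * b := by exact_mod_cast huv.symm
  rw [this]
  exact dvd_add (ha.mul_left _) (hb.mul_left _)

theorem associated_of_dvd {p : 𝓞 TribField} (hp : Prime p) {a b : ℤ} (h : IsCoprime a b)
    (h1 : p ∣ a - theta * b) (h2 : p ∣ a ^ 2 + theta * a * b + (theta ^ 2 - 4) * b ^ 2) :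
    Associated p varpi ∨ Associated p rho := by
  have h3 : p ∣ varpi ^ 4 * tau ^ 2 * rho * b ^ 2 := by
    have e : varpi ^ 4 * tau ^ 2 * rho * b ^ 2 =
        (a + 2 * theta * b) * (a - theta * b) -
          (a ^ 2 + theta * a * b + (theta ^ 2 - 4) * b ^ 2) := by
      linear_combination (b ^ 2 : 𝓞 TribField) * three_mul_theta_sq_sub_four +
        (b ^ 2 * varpi * rho : 𝓞 TribField) * two_eq
    rw [e]
    exact dvd_sub (h1.mul_left _) h2
  have hb : ¬ p ∣ b := fun hb => by
    have ha : p ∣ (a : 𝓞 TribField) := by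
      have := dvd_add h1 (hb.mul_left theta)
      rwa [sub_add_cancel] at this
    exact not_dvd_of_isCoprime hp h ha hb
  rcases hp.dvd_or_dvd h3 with h3 | h3
  · rcases hp.dvd_or_dvd h3 with h3 | h3
    · rcases hp.dvd_or_dvd h3 with h3 | h3
      · exact .inl (hp.associated_of_dvd prime_varpi (hp.dvd_of_dvd_pow h3))
      · exact absurd (isUnit_of_dvd_unit (hp.dvd_of_dvd_pow h3) isUnit_tau) hp.not_isUnit
    · exact .inr (hp.associated_of_dvd prime_rho h3)
  · exact absurd (hp.dvd_of_dvd_pow h3) hb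

theorem exists_peel {p k : 𝓞 TribField} (hp : Prime p) (hk : Squarefree k) :
    ∃ l, Squarefree l ∧ ¬ p ∣ l ∧ l ∣ k ∧ (k = l ∨ k = p * l) := by
  by_cases h : p ∣ k
  · obtain ⟨l, rfl⟩ := h
    exact ⟨l, hk.of_mul_right, fun ⟨m, hm⟩ => hp.not_isUnit (hk p ⟨m, by rw [hm]; ring⟩),
      dvd_mul_left _ _, .inr rfl⟩
  · exact ⟨k, hk, h, dvd_rfl, .inl rfl⟩

theorem not_mul_sq_eq_sq {n : ℕ} (hn : n ≠ 1) (hn' : n < 25) (h4 : n ≠ 4) (h9 : n ≠ 9)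
    (h16 : n ≠ 16) {x y : ℕ} (hy : y ≠ 0) : n * x ^ 2 ≠ y ^ 2 := by
  intro h
  have h1 : x ^ 2 ∣ y ^ 2 := ⟨n, by rw [← h, mul_comm]⟩
  obtain ⟨w, rfl⟩ := (Nat.pow_dvd_pow_iff two_ne_zero).1 h1
  have hx : x ≠ 0 := by rintro rfl; simp at hy
  have h2 : n = w ^ 2 := by
    apply Nat.eq_of_mul_eq_mul_right (pow_pos (Nat.pos_of_ne_zero hx) 2)
    rw [h]; ring
  have : w < 5 := by nlinarith
  have hw : w ≠ 0 := by rintro rfl; simp at hy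
  interval_cases w <;> omega

theorem sub_theta_mul_eq_unit_mul_sq {a b z d : ℤ} (hab : IsCoprime a b) (hd : IsUnit d)
    (hz : z ≠ 0) (h : a ^ 3 - 4 * a * b ^ 2 + 4 * b ^ 3 = d * z ^ 2) :
    ∃ (u : (𝓞 TribField)ˣ) (g : 𝓞 TribField), (a - theta * b : 𝓞 TribField) = u * g ^ 2 := by
  have hprod : (a - theta * b : 𝓞 TribField) * (a ^ 2 + theta * a * b + (theta ^ 2 - 4) * b ^ 2) =
      d * z ^ 2 := by
    have h' : (a ^ 3 - 4 * a * b ^ 2 + 4 * b ^ 3 : 𝓞 TribField) = d * z ^ 2 := by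
      exact_mod_cast congrArg (Int.cast : ℤ → 𝓞 TribField) h
    rw [← h']
    linear_combination -(b : 𝓞 TribField) ^ 3 * theta_cube
  have hd' : IsUnit (d : 𝓞 TribField) := hd.map (Int.castRingHom (𝓞 TribField))
  have hz' : (z : 𝓞 TribField) ≠ 0 := by exact_mod_cast hz
  have hα : (a - theta * b : 𝓞 TribField) ≠ 0 := by
    intro h0
    rw [h0, zero_mul] at hprod
    exact mul_ne_zero hd'.ne_zero (pow_ne_zero 2 hz') hprod.symm
  obtain ⟨k, g, hk, hsq⟩ := exists_squarefree_mul_sq hα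
  have hg : g ≠ 0 := by rintro rfl; exact hα (by rw [hk]; ring)
  have hnorm := congrArg (fun x => (Algebra.norm ℤ x).natAbs) hk
  simp only [norm_sub_theta_mul, h, map_mul, map_pow, Int.natAbs_mul, Int.natAbs_pow,
    Int.isUnit_iff_natAbs_eq.1 hd, one_mul] at hnorm
  obtain ⟨l, hl, hpl, hlk, hkl⟩ := exists_peel prime_varpi hsq
  obtain ⟨m, hm, hpm, hml, hlm⟩ := exists_peel prime_rho hl
  have hmu : IsUnit m := by
    by_contra hmu
    obtain ⟨p, hp, hpm'⟩ := WfDvdMonoid.exists_irreducible_factor hmu hm.ne_zero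
    rw [irreducible_iff_prime] at hp
    have hpk : p ∣ k := hpm'.trans (hml.trans hlk)
    have h2 := hp.dvd_of_dvd_squarefree hsq hg hd' (hk ▸ hprod) hpk
    rcases associated_of_dvd hp hab (hk ▸ hpk.mul_right _) h2 with h | h
    · exact hpl (h.symm.dvd.trans (hpm'.trans hml))
    · exact hpm (h.symm.dvd.trans hpm')
  have hmn := isUnit_iff_natAbs_norm.1 hmu
  have hzn : z.natAbs ≠ 0 := by simpa using hz
  have hku : IsUnit k := by
    rcases hkl with rfl | rfl <;> rcases hlm with rfl | rfl
    · exact hmu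
    · rw [map_mul, Int.natAbs_mul, hmn, norm_rho] at hnorm
      exact absurd hnorm.symm (not_mul_sq_eq_sq (by decide) (by decide) (by decide) (by decide)
        (by decide) hzn)
    · rw [map_mul, Int.natAbs_mul, hmn, norm_varpi] at hnorm
      exact absurd hnorm.symm (not_mul_sq_eq_sq (by decide) (by decide) (by decide) (by decide)
        (by decide) hzn)
    · rw [map_mul, map_mul, Int.natAbs_mul, Int.natAbs_mul, hmn, norm_varpi, norm_rho] at hnorm
      exact absurd hnorm.symm (not_mul_sq_eq_sq (by decide) (by decide) (by decide) (by decide)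
        (by decide) hzn)
  exact ⟨hku.unit, g, hk⟩

theorem sq_sub_theta_mul_ne {s b : ℤ} (h : IsCoprime s b) {σ : 𝓞 TribField} (hσ : σ = 1 ∨ σ = -1)
    (g : 𝓞 TribField) : (s ^ 2 - theta * b : 𝓞 TribField) ≠ σ * tau * g ^ 2 := by
  obtain ⟨t, rfl | rfl⟩ := Int.even_or_odd' s
  · obtain ⟨c, rfl | rfl⟩ := Int.even_or_odd' b
    · exact absurd (h.isUnit_of_dvd' (dvd_mul_right 2 t) (dvd_mul_right 2 c)) (by decide)
    intro h1
    have h2 : varpi ∣ g := by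
      apply prime_varpi.dvd_of_dvd_pow (n := 2)
      have : IsUnit (σ * tau) := IsUnit.mul (by rcases hσ with rfl | rfl <;> simp) isUnit_tau
      rw [← this.dvd_mul_left, ← h1, theta_eq]
      exact ⟨-varpi ^ 2 * tau ^ 2 * (2 * t ^ 2) + varpi * tau ^ 2 * (2 * c + 1 : ℤ), by
        push_cast; linear_combination 2 * (t : 𝓞 TribField) ^ 2 * two_eq⟩
    obtain ⟨g, rfl⟩ := h2
    obtain ⟨e, he⟩ := sq_dvd_two
    refine ne_tau_mul_sq (x := tau ^ 2 * (2 * c + 1) + varpi ^ 4 * tau ^ 4 * t ^ 2) (g := g)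
      ⟨1 - varpi * e + e * c * tau ^ 2 + varpi ^ 2 * tau ^ 4 * t ^ 2, ?_⟩ hσ ?_
    · rw [tau]
      linear_combination (c * (1 - varpi) ^ 2 - varpi) * he
    · apply mul_left_cancel₀ (pow_ne_zero 2 prime_varpi.ne_zero)
      push_cast at h1
      linear_combination h1 + (2 * c + 1 : 𝓞 TribField) * theta_eq -
        (t ^ 2 * (2 - varpi ^ 3 * tau ^ 2) : 𝓞 TribField) * two_eq
  · obtain ⟨e, he⟩ := sq_dvd_two
    refine ne_tau_mul_sq
      ⟨2 * e * (t ^ 2 + t) + tau ^ 2 * b, ?_⟩ hσ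
    push_cast
    linear_combination (2 * t ^ 2 + 2 * t : 𝓞 TribField) * he - (b : 𝓞 TribField) * theta_eq

theorem sq_sub_theta_mul_eq {s b z d : ℤ} (hab : IsCoprime s b) (hd : d = 1 ∨ d = -1)
    (hz : z ≠ 0) (h : s ^ 6 - 4 * s ^ 2 * b ^ 2 + 4 * b ^ 3 = d * z ^ 2) :
    ∃ g : 𝓞 TribField, (s ^ 2 - theta * b : 𝓞 TribField) = d * g ^ 2 := by
  obtain ⟨u, g, hu⟩ := sub_theta_mul_eq_unit_mul_sq (hab.pow_left (m := 2))
    (Int.isUnit_iff.2 hd) hz (by rw [← h]; ring)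
  obtain ⟨e, σ, hσ, hu' | hu'⟩ := unit_eq u
  · refine ⟨e * g, ?_⟩
    have hnorm := congrArg (Algebra.norm ℤ) hu
    have h1 := norm_sub_theta_mul (s ^ 2) b
    push_cast at h1 hu
    rw [hu, hu'] at h1
    have hn1 : Algebra.norm ℤ (-1 : 𝓞 TribField) = -1 := by simpa using norm_int_eq (-1) 0 0
    have hσd : σ = d := by
      have h2 : s ^ 6 - 4 * s ^ 2 * b ^ 2 + 4 * b ^ 3 =
          Algebra.norm ℤ σ * (Algebra.norm ℤ e * Algebra.norm ℤ g) ^ 2 := by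
        simp only [map_mul, map_pow] at h1
        linear_combination -h1
      rw [h] at h2
      have := pow_pos (abs_pos.2 hz) 2
      rw [sq_abs] at this
      rcases hσ with rfl | rfl <;> rcases hd with rfl | rfl
      · simp
      · rw [map_one] at h2; nlinarith [sq_nonneg (Algebra.norm ℤ e * Algebra.norm ℤ g)]
      · rw [hn1] at h2; nlinarith [sq_nonneg (Algebra.norm ℤ e * Algebra.norm ℤ g)]
      · simp
    rw [hu, hu', hσd]
    ring
  · refine absurd ?_ (sq_sub_theta_mul_ne hab hσ (e * g))
    rw [hu'] at hu
    push_cast at hu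
    rw [hu]
    ring

theorem exists_halving {s b z d : ℤ} (hab : IsCoprime s b) (hd : d = 1 ∨ d = -1)
    (hs : s ≠ 0) (hz : z ≠ 0) (h : s ^ 6 - 4 * s ^ 2 * b ^ 2 + 4 * b ^ 3 = d * z ^ 2) :
    ∃ v w : ℚ, w ≠ 0 ∧ d * (4 * v ^ 3 - 4 * v ^ 2 + 1) = w ^ 2 ∧
      b / s ^ 2 * (4 * v ^ 3 - 4 * v ^ 2 + 1) = v ^ 4 - 2 * v + 1 := by
  obtain ⟨g, hg⟩ := sq_sub_theta_mul_eq hab hd hz h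
  obtain ⟨P, Q, R, hrep⟩ := exists_rep (g * ϖ ^ 2 * (1 - ϖ) / s)
  have hsK : (s : TribField) ≠ 0 := by exact_mod_cast hs
  have hsQ : (s : ℚ) ≠ 0 := by exact_mod_cast hs
  have hgK : (s ^ 2 - (2 * ϖ - ϖ ^ 2) * b : TribField) = d * g ^ 2 := by
    have h1 := congrArg (algebraMap (𝓞 TribField) TribField) hg
    have h2 : algebraMap (𝓞 TribField) TribField 2 = 2 := map_ofNat _ 2
    have h3 : algebraMap (𝓞 TribField) TribField varpi = ϖ := rfl
    rw [theta] at h1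
    simpa only [map_sub, map_mul, map_pow, map_intCast, h2, h3] using h1
  have hdK : (d : TribField) ^ 2 = 1 := by rcases hd with rfl | rfl <;> simp
  have hdQ : (d : ℚ) ^ 2 = 1 := by rcases hd with rfl | rfl <;> simp
  have hdd : (d : ℚ) ≠ 0 := by rcases hd with rfl | rfl <;> simp
  have hsq : (d * (4 * b / s ^ 2 - 2 * ϖ) : TribField) = (P + Q * ϖ + R * ϖ ^ 2) ^ 2 := by
    rw [← hrep]
    field_simp
    linear_combination -2 * d * ϖ * hgK - 2 * ϖ * g ^ 2 * hdK +
      (2 * d * b - g ^ 2 * ϖ * (ϖ ^ 2 + 1)) * ϖ_cube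
  have hzero := rep_eq_zero (p := P ^ 2 - 4 * Q * R - 4 * R ^ 2 - d * (4 * b / s ^ 2))
    (q := 2 * P * Q - 2 * R ^ 2 + 2 * d) (r := Q ^ 2 + 2 * P * R + 4 * Q * R + 4 * R ^ 2) (by
      push_cast
      linear_combination -hsq - (2 * Q * R + R ^ 2 * ϖ + 2 * R ^ 2) * ϖ_cube)
  obtain ⟨h1, h2, h3⟩ := hzero
  have hR : R ≠ 0 := by
    rintro rfl
    have : Q = 0 := by simpa using h3
    subst this
    simp [hdd] at h2
  have hn : Q = (Q / R) * R := by field_simp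
  set n := Q / R
  have hP : P = -R * (n + 2) ^ 2 / 2 := by
    apply mul_left_cancel₀ hR
    rw [hn] at h3
    linear_combination h3 / 2
  have e1 : d * R ^ 2 * (4 * ((n + 2) / 2) ^ 3 - 4 * ((n + 2) / 2) ^ 2 + 1) = 1 := by
    rw [hP, hn] at h2
    linear_combination (-d / 2) * h2 + hdQ
  have e2 : d * R ^ 2 * (((n + 2) / 2) ^ 4 - 2 * ((n + 2) / 2) + 1) = b / s ^ 2 := by
    rw [hP, hn] at h1
    linear_combination (d / 4) * h1 + b / s ^ 2 * hdQ
  refine ⟨(n + 2) / 2, 1 / R, by positivity, ?_, ?_⟩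
  · rw [one_div, inv_pow, ← one_div, eq_div_iff (by positivity)]
    linear_combination e1
  · have : (d * R ^ 2 : ℚ) ≠ 0 := by positivity
    apply mul_left_cancel₀ this
    rw [e2]
    linear_combination b / s ^ 2 * e1

end

end TribField

end CubicField

theorem Rat.exists_coprime_sq_den {u y : ℚ} {d : ℤ} (hd : d = 1 ∨ d = -1)
    (h : d * (4 * u ^ 3 - 4 * u ^ 2 + 1) = y ^ 2) :
    ∃ s z : ℤ, s ≠ 0 ∧ z ≠ 0 ∧ (u.den : ℤ) = s ^ 2 ∧
      s ^ 6 - 4 * s ^ 2 * u.num ^ 2 + 4 * u.num ^ 3 = d * z ^ 2 := by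
  have ha : (u.den : ℚ) ≠ 0 := by exact_mod_cast u.den_nz
  obtain ⟨m, hm⟩ := Rat.exists_int_eq_of_sq_eq (y := y * u.den ^ 2)
    (n := u.den * (d * (u.den ^ 3 - 4 * u.den * u.num ^ 2 + 4 * u.num ^ 3))) (by
      rw [mul_pow, ← h]
      have hu : u * u.den = u.num := Rat.mul_den_eq_num u
      push_cast
      rw [← hu]
      ring)
  obtain ⟨s, z, hs, hz, hsa, h⟩ := exists_sq_of_mul_cubic_eq_sq (a := u.den) (b := u.num)
    (d := d) (y := m) (by exact_mod_cast u.den_pos) (Rat.isCoprime_num_den u).symm hd (by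
      have : (m : ℚ) ^ 2 = (u.den * (d * (u.den ^ 3 - 4 * u.den * u.num ^ 2 + 4 * u.num ^ 3)) :
          ℤ) := by
        rw [← hm, mul_pow, ← h]
        have hu : u * u.den = u.num := Rat.mul_den_eq_num u
        push_cast
        rw [← hu]
        ring
      exact_mod_cast this.symm)
  exact ⟨s, z, hs, hz, hsa, by rw [← h, hsa]; ring⟩

/-- The abscissa of the double of a point has larger height, up to a factor dividing `11`. -/
theorem Rat.duplication_bound {u v : ℚ} (hv : 4 * v ^ 3 - 4 * v ^ 2 + 1 ≠ 0)
    (h : u * (4 * v ^ 3 - 4 * v ^ 2 + 1) = v ^ 4 - 2 * v + 1) :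
    |v.num ^ 4 - 2 * v.num * v.den ^ 3 + v.den ^ 4| ≤ 11 * |u.num| ∧
    |(v.den : ℤ) * (4 * v.num ^ 3 - 4 * v.num ^ 2 * v.den + v.den ^ 3)| ≤ 11 * (u.den : ℤ) := by
  have hA : (v.den : ℚ) ≠ 0 := by exact_mod_cast v.den_nz
  have ha : (u.den : ℚ) ≠ 0 := by exact_mod_cast u.den_nz
  have hBA : v * v.den = v.num := Rat.mul_den_eq_num v
  have hba : u * u.den = u.num := Rat.mul_den_eq_num u
  have hcop := Rat.isCoprime_num_den v
  have hcop' := Rat.isCoprime_num_den u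
  set A : ℤ := (v.den : ℤ) with hAd
  set B : ℤ := v.num
  set a : ℤ := (u.den : ℤ) with had
  set b : ℤ := u.num
  have hAA : (v.den : ℚ) = A := rfl
  have haa : (u.den : ℚ) = a := rfl
  rw [hAA] at hA hBA
  rw [haa] at ha hba
  set n := B ^ 4 - 2 * B * A ^ 3 + A ^ 4 with hn
  set D := A * (4 * B ^ 3 - 4 * B ^ 2 * A + A ^ 3) with hD
  have hD0 : D ≠ 0 := by
    have : (D : ℚ) = A ^ 4 * (4 * v ^ 3 - 4 * v ^ 2 + 1) := by
      rw [hD]; push_cast; rw [← hBA]; ring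
    have h1 : (D : ℚ) ≠ 0 := by rw [this]; positivity
    exact_mod_cast h1
  have hcross : b * D = n * a := by
    have : (b * D : ℚ) = n * a := by
      rw [hD, hn]; push_cast
      rw [← hba, ← hBA]
      linear_combination a * A ^ 4 * h
    exact_mod_cast this
  have ha0 : a ≠ 0 := by exact_mod_cast ha
  obtain ⟨g, hg⟩ : a ∣ D := hcop'.symm.dvd_of_dvd_mul_left ⟨n, by rw [hcross]; ring⟩
  have hg' : n = b * g := by
    apply mul_right_cancel₀ ha0
    rw [← hcross, hg]; ring
  have h11 : g ∣ 11 := by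
    have hA7 : g ∣ 11 * A ^ 7 := by
      have e : 11 * A ^ 7 = (48 * A * B ^ 2 - 32 * A ^ 2 * B - 16 * A ^ 3) * n +
        (-12 * B ^ 3 - 4 * A * B ^ 2 + 27 * A ^ 3) * D := by rw [hn, hD]; ring
      rw [e]
      exact dvd_add (hg' ▸ (dvd_mul_left g b).mul_left _) (hg ▸ (dvd_mul_left g a).mul_left _)
    have hB7 : g ∣ 11 * B ^ 7 := by
      have e : 11 * B ^ 7 = (11 * B ^ 3 - 20 * A * B ^ 2 + 4 * A ^ 2 * B + 6 * A ^ 3) * n +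
        (5 * B ^ 3 + 4 * A * B ^ 2 + 8 * A ^ 2 * B - 6 * A ^ 3) * D := by rw [hn, hD]; ring
      rw [e]
      exact dvd_add (hg' ▸ (dvd_mul_left g b).mul_left _) (hg ▸ (dvd_mul_left g a).mul_left _)
    obtain ⟨x, y, hxy⟩ := (hcop.pow (m := 7) (n := 7))
    have : (11 : ℤ) = x * (11 * B ^ 7) + y * (11 * A ^ 7) := by linear_combination -11 * hxy
    rw [this]
    exact dvd_add (hB7.mul_left _) (hA7.mul_left _)
  have hg11 : |g| ≤ 11 := by
    rw [← abs_dvd] at h11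
    exact Int.le_of_dvd (by norm_num) h11
  have ha_pos : 0 < a := by rw [had]; exact_mod_cast u.den_pos
  rw [hg', hg, abs_mul, abs_mul, abs_of_pos ha_pos]
  constructor <;> nlinarith [abs_nonneg b]

/-- The rational points of `d y² = 4 u³ - 4 u² + 1` for `d = ±1`. -/
theorem Rat.eq_zero_or_one_of_cubic_eq_sq {u y : ℚ} {d : ℤ} (hd : d = 1 ∨ d = -1)
    (h : d * (4 * u ^ 3 - 4 * u ^ 2 + 1) = y ^ 2) : d = 1 ∧ (u = 0 ∨ u = 1) := by
  induction hN : max |u.num| u.den using Int.strongRec (m := 0) generalizing u y with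
  | lt N hN0 =>
    have := abs_nonneg u.num
    omega
  | ge N _ ih =>
    obtain ⟨s, z, hs, hz, hden, hsz⟩ := Rat.exists_coprime_sq_den hd h
    have hcop : IsCoprime s u.num := by
      have := (Rat.isCoprime_num_den u).symm
      rw [hden] at this
      exact this.of_isCoprime_of_dvd_left (dvd_pow_self s two_ne_zero)
    obtain ⟨v, w, hw, hvw, huv⟩ := TribField.exists_halving hcop hd hs hz hsz
    have hu : (u.num / s ^ 2 : ℚ) = u := by
      have : (s ^ 2 : ℚ) = u.den := by exact_mod_cast hden.symm
      rw [this, Rat.num_div_den]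
    rw [hu] at huv
    have hv0 : 4 * v ^ 3 - 4 * v ^ 2 + 1 ≠ 0 := by
      intro h0
      rw [h0, mul_zero] at hvw
      exact hw (by simpa using hvw.symm)
    have hv : d = 1 ∧ (v = 0 ∨ v = 1) := by
      by_cases hlt : max |v.num| v.den < N
      · exact ih _ hlt hvw rfl
      obtain ⟨S, W, hS, -, hSden, hSW⟩ := Rat.exists_coprime_sq_den hd hvw
      have hbound := Rat.duplication_bound hv0 huv
      have := le_three_of_duplication_le (A := v.den) (B := v.num) (M := max |v.num| v.den)
        (by exact_mod_cast v.den_pos) rfl (by omega) (by omega)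
      obtain ⟨hA, hB⟩ := this
      have hA1 : (v.den : ℤ) = 1 := by
        have : S < 2 := by nlinarith
        have : -2 < S := by nlinarith
        rw [hSden]
        interval_cases S <;> simp_all
      have hvB : v = v.num := by
        have : (v.den : ℚ) = 1 := by exact_mod_cast hA1
        rw [← Rat.mul_den_eq_num v, this, mul_one]
      have hSB : 1 - 4 * v.num ^ 2 + 4 * v.num ^ 3 = d * W ^ 2 := by
        rw [← hSW, show S ^ 6 = (S ^ 2) ^ 3 by ring, ← hSden, hA1]
        ring
      rw [hvB]
      generalize v.num = B at hB hSB
      obtain ⟨h1, h2⟩ := abs_le.1 hB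
      have hW : |W| < 12 := by
        rw [← sq_lt_sq₀ (abs_nonneg _) (by norm_num), sq_abs]
        rcases hd with rfl | rfl <;> interval_cases B <;> omega
      obtain ⟨h3, h4⟩ := abs_lt.1 hW
      rcases hd with rfl | rfl <;> interval_cases B <;> simp at hSB ⊢ <;>
        interval_cases W <;> omega
    obtain ⟨rfl, rfl | rfl⟩ := hv
    · exact ⟨rfl, .inr (by linarith)⟩
    · exact ⟨rfl, .inl (by linarith)⟩

section CommonPrimes

variable {p a b : ℤ}

theorem Prime.not_dvd_of_isCoprime_of_dvd (hp : Prime p) (h : IsCoprime a b) (ha : p ∣ a) :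
    ¬ p ∣ b :=
  fun hb => hp.not_isUnit (h.isUnit_of_dvd' ha hb)

theorem Prime.not_dvd_of_dvd_sub (hp : Prime p) (h : IsCoprime a b) {k l : ℤ}
    (hkl : p ∣ a - k * b) (hl : p ∣ l * b ^ 3) : p ∣ l := by
  refine (hp.dvd_or_dvd hl).resolve_right fun hb => ?_
  have hb := hp.dvd_of_dvd_pow hb
  have ha : p ∣ a := by
    have := dvd_add hkl (hb.mul_left k)
    rwa [sub_add_cancel] at this
  exact hp.not_dvd_of_isCoprime_of_dvd h ha hb

theorem Prime.not_dvd_second_of_dvd_first (hp : Prime p) (h2 : ¬ p ∣ 2) (h : IsCoprime a b)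
    (hf : p ∣ a ^ 3 - 2 * a ^ 2 * b + 2 * b ^ 3) : ¬ p ∣ a ^ 3 - 4 * a * b ^ 2 + 4 * b ^ 3 := by
  intro hg
  have h3 : p ∣ 2 * (b * (a - b) ^ 2) := by
    rw [show 2 * (b * (a - b) ^ 2) = (a ^ 3 - 4 * a * b ^ 2 + 4 * b ^ 3) -
      (a ^ 3 - 2 * a ^ 2 * b + 2 * b ^ 3) by ring]
    exact dvd_sub hg hf
  rcases hp.dvd_or_dvd ((hp.dvd_or_dvd h3).resolve_left h2) with hb | hab
  · have ha : p ∣ a := by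
      apply hp.dvd_of_dvd_pow (n := 3)
      rw [show a ^ 3 = (a ^ 3 - 2 * a ^ 2 * b + 2 * b ^ 3) + b * (2 * a ^ 2 - 2 * b ^ 2) by ring]
      exact dvd_add hf (hb.mul_right _)
    exact hp.not_dvd_of_isCoprime_of_dvd h ha hb
  · have hab := hp.dvd_of_dvd_pow hab
    apply hp.not_dvd_one
    apply hp.not_dvd_of_dvd_sub h (k := 1) (by simpa using hab)
    rw [show 1 * b ^ 3 = (a ^ 3 - 2 * a ^ 2 * b + 2 * b ^ 3) -
      (a - b) * (a ^ 2 - a * b - b ^ 2) by ring]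
    exact dvd_sub hf (hab.mul_right _)

theorem Prime.not_dvd_third_of_dvd_first (hp : Prime p) (h2 : ¬ p ∣ 2) (h : IsCoprime a b)
    (hf : p ∣ a ^ 3 - 2 * a ^ 2 * b + 2 * b ^ 3) : ¬ p ∣ a ^ 3 + 2 * a ^ 2 * b - 2 * b ^ 3 := by
  intro hg
  have ha : p ∣ a := by
    have h3 : p ∣ 2 * a ^ 3 := by
      rw [show 2 * a ^ 3 = (a ^ 3 - 2 * a ^ 2 * b + 2 * b ^ 3) +
        (a ^ 3 + 2 * a ^ 2 * b - 2 * b ^ 3) by ring]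
      exact dvd_add hf hg
    exact hp.dvd_of_dvd_pow ((hp.dvd_or_dvd h3).resolve_left h2)
  have hb : p ∣ b := by
    have h3 : p ∣ 2 * b ^ 3 := by
      rw [show 2 * b ^ 3 = (a ^ 3 - 2 * a ^ 2 * b + 2 * b ^ 3) - a * (a ^ 2 - 2 * a * b) by ring]
      exact dvd_sub hf (ha.mul_right _)
    exact hp.dvd_of_dvd_pow ((hp.dvd_or_dvd h3).resolve_left h2)
  exact hp.not_dvd_of_isCoprime_of_dvd h ha hb

theorem Prime.dvd_eleven_of_dvd_second_third (hp : Prime p) (h2 : ¬ p ∣ 2) (h : IsCoprime a b)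
    (hf : p ∣ a ^ 3 - 4 * a * b ^ 2 + 4 * b ^ 3) (hg : p ∣ a ^ 3 + 2 * a ^ 2 * b - 2 * b ^ 3) :
    p ∣ 11 ∧ p ∣ a + 3 * b := by
  have h3 : p ∣ 2 * (b * ((a - b) * (a + 3 * b))) := by
    rw [show 2 * (b * ((a - b) * (a + 3 * b))) = (a ^ 3 + 2 * a ^ 2 * b - 2 * b ^ 3) -
      (a ^ 3 - 4 * a * b ^ 2 + 4 * b ^ 3) by ring]
    exact dvd_sub hg hf
  rcases hp.dvd_or_dvd ((hp.dvd_or_dvd h3).resolve_left h2) with hb | hab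
  · have ha : p ∣ a := by
      apply hp.dvd_of_dvd_pow (n := 3)
      rw [show a ^ 3 = (a ^ 3 - 4 * a * b ^ 2 + 4 * b ^ 3) + b * (4 * a * b - 4 * b ^ 2) by ring]
      exact dvd_add hf (hb.mul_right _)
    exact absurd hb (hp.not_dvd_of_isCoprime_of_dvd h ha)
  rcases hp.dvd_or_dvd hab with hab | hab
  · refine absurd (hp.not_dvd_of_dvd_sub h (k := 1) (l := 1) (by simpa using hab) ?_)
      hp.not_dvd_one
    rw [show 1 * b ^ 3 = (a ^ 3 - 4 * a * b ^ 2 + 4 * b ^ 3) -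
      (a - b) * (a ^ 2 + a * b - 3 * b ^ 2) by ring]
    exact dvd_sub hf (hab.mul_right _)
  · refine ⟨hp.not_dvd_of_dvd_sub h (k := -3) (by simpa using hab) ?_, hab⟩
    rw [show 11 * b ^ 3 = (a + 3 * b) * (a ^ 2 - 3 * a * b + 5 * b ^ 2) -
      (a ^ 3 - 4 * a * b ^ 2 + 4 * b ^ 3) by ring]
    exact dvd_sub (hab.mul_right _) hf

end CommonPrimes

theorem Int.prime_eleven : Prime (11 : ℤ) := by
  exact_mod_cast Nat.prime_iff_prime_int.1 (by norm_num : Nat.Prime 11)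

theorem not_sq_eleven_dvd_second_third {a b : ℤ} (h : IsCoprime a b) (hab : 11 ∣ a + 3 * b)
    (hf : 11 ^ 2 ∣ a ^ 3 - 4 * a * b ^ 2 + 4 * b ^ 3) :
    ¬ 11 ^ 2 ∣ a ^ 3 + 2 * a ^ 2 * b - 2 * b ^ 3 := by
  intro hg
  obtain ⟨k, hk⟩ := hab
  obtain rfl : a = 11 * k - 3 * b := by linarith
  have hb : ¬ 11 ∣ b := fun hb => by
    refine Int.prime_eleven.not_dvd_of_isCoprime_of_dvd h ?_ hb
    exact dvd_sub (dvd_mul_right _ _) (hb.mul_left _)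
  have aux {l : ℤ} (hl : 11 ^ 2 ∣ 11 * (b ^ 2 * l)) : 11 ∣ l := by
    rw [sq, mul_dvd_mul_iff_left (by norm_num)] at hl
    exact (Int.prime_eleven.dvd_or_dvd hl).resolve_left fun h =>
      hb (Int.prime_eleven.dvd_of_dvd_pow h)
  have h1 : 11 ∣ 23 * k - b := by
    apply aux
    rw [show 11 * (b ^ 2 * (23 * k - b)) = ((11 * k - 3 * b) ^ 3 - 4 * (11 * k - 3 * b) * b ^ 2 +
      4 * b ^ 3) - 11 ^ 2 * (11 * k ^ 3 - 9 * k ^ 2 * b) by ring]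
    exact dvd_sub hf (dvd_mul_right _ _)
  have h2 : 11 ∣ 15 * k - b := by
    apply aux
    rw [show 11 * (b ^ 2 * (15 * k - b)) = ((11 * k - 3 * b) ^ 3 + 2 * (11 * k - 3 * b) ^ 2 * b -
      2 * b ^ 3) - 11 ^ 2 * (11 * k ^ 3 - 7 * k ^ 2 * b) by ring]
    exact dvd_sub hg (dvd_mul_right _ _)
  omega

theorem eleven_dvd_of_sq_eq_mul_sq {x y m c : ℤ} (hc : c = 2 ∨ c = -1)
    (h : x ^ 2 = c * y ^ 2 + 11 * m) : 11 ∣ y := by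
  have h' := congrArg (Int.cast : ℤ → ZMod 11) h
  have h0 : (11 : ZMod 11) = 0 := by decide
  push_cast at h'
  rw [h0, zero_mul, add_zero] at h'
  refine (ZMod.intCast_zmod_eq_zero_iff_dvd y 11).1 ?_
  generalize (y : ZMod 11) = y at *
  generalize (x : ZMod 11) = x at *
  rcases hc with rfl | rfl <;> push_cast at h' <;> revert x y <;> decide

theorem Int.ne_zero_of_odd {n : ℤ} (h : Odd n) : n ≠ 0 := by
  rintro rfl
  simp at h

theorem Odd.intCast_zmod_eight_sq {n : ℤ} (h : Odd n) : (n : ZMod 8) ^ 2 = 1 := by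
  obtain ⟨k, rfl⟩ := h
  push_cast
  generalize (k : ZMod 8) = k
  revert k
  decide

theorem Int.isCoprime_of_odd_of_prime_dvd {f g : ℤ} (hf : Odd f)
    (h : ∀ p : ℤ, Prime p → ¬ p ∣ 2 → p ∣ f → ¬ p ∣ g) : IsCoprime f g := by
  refine isCoprime_of_prime_dvd (fun h0 => ?_) fun p hp hpf => h p hp (fun h2 => ?_) hpf
  · simp [h0.1] at hf
  · obtain ⟨k, rfl⟩ := hf
    exact hp.not_dvd_one ((dvd_add_right (h2.mul_right k)).1 hpf)

section Factors

variable {a b f g h : ℤ}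

theorem isCoprime_first_mul (hab : IsCoprime a b) (hfo : Odd f)
    (hf : f ∣ a ^ 3 - 2 * a ^ 2 * b + 2 * b ^ 3) (hg : g ∣ a ^ 3 - 4 * a * b ^ 2 + 4 * b ^ 3)
    (hh : h ∣ a ^ 3 + 2 * a ^ 2 * b - 2 * b ^ 3) : IsCoprime f (g * h) :=
  .mul_right
    (Int.isCoprime_of_odd_of_prime_dvd hfo fun _ hp h2 hpf hpg =>
      hp.not_dvd_second_of_dvd_first h2 hab (hpf.trans hf) (hpg.trans hg))
    (Int.isCoprime_of_odd_of_prime_dvd hfo fun _ hp h2 hpf hph =>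
      hp.not_dvd_third_of_dvd_first h2 hab (hpf.trans hf) (hph.trans hh))

theorem isCoprime_or_eleven_dvd (hab : IsCoprime a b) (hgo : Odd g)
    (hg : g ∣ a ^ 3 - 4 * a * b ^ 2 + 4 * b ^ 3) (hh : h ∣ a ^ 3 + 2 * a ^ 2 * b - 2 * b ^ 3) :
    IsCoprime g h ∨ 11 ∣ g ∧ 11 ∣ h ∧ 11 ∣ a + 3 * b := by
  by_contra! hcon
  refine hcon.1 (Int.isCoprime_of_odd_of_prime_dvd hgo fun p hp h2 hpg hph => ?_)
  obtain ⟨h11, h3⟩ := hp.dvd_eleven_of_dvd_second_third h2 hab (hpg.trans hg) (hph.trans hh)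
  have := (hp.associated_of_dvd Int.prime_eleven h11).symm.dvd
  exact hcon.2 (this.trans hpg) (this.trans hph) (this.trans h3)

theorem eq_mul_sq_of_isCoprime (hfg : IsCoprime f g) {c z : ℤ} (hc : c = 1 ∨ c = -1)
    (h : f * g = c * z ^ 2) (hf : f ≠ 0) :
    ∃ d x y : ℤ, (d = 1 ∨ d = -1) ∧ f = d * x ^ 2 ∧ g = d * c * y ^ 2 := by
  have hcu : IsUnit c := Int.isUnit_iff.2 hc
  have hcc : c * c = 1 := by rcases hc with rfl | rfl <;> rfl
  have hfg' := (isCoprime_mul_unit_left_right hcu f g).2 hfg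
  have h' : f * (c * g) = z ^ 2 := by linear_combination c * h + z ^ 2 * hcc
  obtain ⟨x, hx | hx⟩ := Int.sq_of_isCoprime hfg' h'
  · obtain ⟨-, y, -, -, hy⟩ := exists_sq_of_isCoprime_of_mul_eq_sq
      (by rw [hx] at hf ⊢; exact (sq_nonneg x).lt_of_ne' hf) hfg' h'
    exact ⟨1, x, y, .inl rfl, by simpa using hx, by linear_combination c * hy - g * hcc⟩
  · obtain ⟨-, y, -, -, hy⟩ := exists_sq_of_isCoprime_of_mul_eq_sq (a := -f) (f := -(c * g))
      (by rw [hx, neg_neg]; rw [hx] at hf; exact (sq_nonneg x).lt_of_ne' (by simpa using hf))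
      hfg'.neg_neg (by rw [neg_mul_neg, h'])
    exact ⟨-1, x, y, .inr rfl, by simpa using hx, by linear_combination -c * hy - g * hcc⟩

theorem exists_second_eq_mul_sq_of_odd {y : ℤ} (ha : 0 < a) (hao : Odd a) (hab : IsCoprime a b)
    (h : a * ((a ^ 3 - 2 * a ^ 2 * b + 2 * b ^ 3) * ((a ^ 3 - 4 * a * b ^ 2 + 4 * b ^ 3) *
      (a ^ 3 + 2 * a ^ 2 * b - 2 * b ^ 3))) = y ^ 2) :
    ∃ s z d : ℤ, (d = 1 ∨ d = -1) ∧ a = s ^ 2 ∧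
      a ^ 3 - 4 * a * b ^ 2 + 4 * b ^ 3 = d * z ^ 2 := by
  have hfo : Odd (a ^ 3 - 2 * a ^ 2 * b + 2 * b ^ 3) := by
    rw [show a ^ 3 - 2 * a ^ 2 * b + 2 * b ^ 3 = a ^ 3 + 2 * (b ^ 3 - a ^ 2 * b) by ring]
    exact hao.pow.add_even (even_two_mul _)
  have hgo : Odd (a ^ 3 - 4 * a * b ^ 2 + 4 * b ^ 3) := by
    rw [show a ^ 3 - 4 * a * b ^ 2 + 4 * b ^ 3 = a ^ 3 + 2 * (2 * b ^ 3 - 2 * a * b ^ 2) by ring]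
    exact hao.pow.add_even (even_two_mul _)
  have hcop := isCoprime_first_mul hab hfo dvd_rfl dvd_rfl dvd_rfl
  have hcop' := isCoprime_or_eleven_dvd hab hgo dvd_rfl dvd_rfl
  have hacop : IsCoprime a ((a ^ 3 - 2 * a ^ 2 * b + 2 * b ^ 3) *
      ((a ^ 3 - 4 * a * b ^ 2 + 4 * b ^ 3) * (a ^ 3 + 2 * a ^ 2 * b - 2 * b ^ 3))) := by
    have h2 : IsCoprime a 2 := by
      obtain ⟨k, rfl⟩ := hao
      exact ⟨1, -k, by ring⟩
    have h3 : IsCoprime a (b ^ 3) := hab.pow_right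
    rw [show a ^ 3 - 2 * a ^ 2 * b + 2 * b ^ 3 = 2 * b ^ 3 + a * (a ^ 2 - 2 * a * b) by ring,
      show a ^ 3 - 4 * a * b ^ 2 + 4 * b ^ 3 = 2 * 2 * b ^ 3 + a * (a ^ 2 - 4 * b ^ 2) by ring,
      show a ^ 3 + 2 * a ^ 2 * b - 2 * b ^ 3 = -(2 * b ^ 3) + a * (a ^ 2 + 2 * a * b) by ring]
    exact .mul_right ((h2.mul_right h3).add_mul_left_right _)
      (.mul_right (((h2.mul_right h2).mul_right h3).add_mul_left_right _)
        ((h2.mul_right h3).neg_right.add_mul_left_right _))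
  obtain ⟨s, z, hs, rfl, hz⟩ := exists_sq_of_isCoprime_of_mul_eq_sq ha hacop h
  have hso : Odd s := by rwa [Int.odd_pow' two_ne_zero] at hao
  obtain ⟨d, x, w, hd, hx, hw⟩ := eq_mul_sq_of_isCoprime (c := 1) (z := z) hcop (.inl rfl)
    (by rw [hz, one_mul]) (Int.ne_zero_of_odd hfo)
  rw [mul_one] at hw
  rcases hcop' with hcop' | ⟨-, ⟨m, hm⟩, h11⟩
  · obtain ⟨c, t, -, hc, ht, -⟩ := eq_mul_sq_of_isCoprime hcop' hd hw (Int.ne_zero_of_odd hgo)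
    exact ⟨s, t, c, hc, rfl, ht⟩
  · exfalso
    rcases hd with rfl | rfl
    · have hs11 := eleven_dvd_of_sq_eq_mul_sq (x := x) (y := s ^ 3) (m := -m) (.inl rfl)
        (by linarith)
      have hs11 := Int.prime_eleven.dvd_of_dvd_pow hs11
      refine Int.prime_eleven.not_dvd_of_isCoprime_of_dvd hab (hs11.trans ⟨s, sq s⟩) ?_
      have := hs11.trans ⟨s, sq s⟩
      omega
    · have hxo : Odd x := by
        rw [hx] at hfo
        simpa [Int.odd_pow', parity_simps] using hfo
      have h8 := congrArg (Int.cast : ℤ → ZMod 8) hx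
      push_cast at h8
      rw [hso.intCast_zmod_eight_sq, hxo.intCast_zmod_eight_sq] at h8
      generalize (b : ZMod 8) = b at h8
      revert b
      decide

theorem exists_second_eq_mul_sq_of_even {e y : ℤ} (he : 0 < e) (hbo : Odd b) (heb : IsCoprime e b)
    (h : e * ((32 * e ^ 3 - 16 * e ^ 2 * b + b ^ 3) * ((16 * e ^ 3 - 4 * e * b ^ 2 + b ^ 3) *
      (32 * e ^ 3 + 16 * e ^ 2 * b - b ^ 3))) = y ^ 2) :
    ∃ s z d : ℤ, (d = 1 ∨ d = -1) ∧ e = s ^ 2 ∧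
      16 * e ^ 3 - 4 * e * b ^ 2 + b ^ 3 = d * z ^ 2 := by
  have hfo : Odd (32 * e ^ 3 - 16 * e ^ 2 * b + b ^ 3) := by
    rw [show 32 * e ^ 3 - 16 * e ^ 2 * b + b ^ 3 = 2 * (16 * e ^ 3 - 8 * e ^ 2 * b) + b ^ 3 by ring]
    exact (even_two_mul _).add_odd hbo.pow
  have hgo : Odd (16 * e ^ 3 - 4 * e * b ^ 2 + b ^ 3) := by
    rw [show 16 * e ^ 3 - 4 * e * b ^ 2 + b ^ 3 = 2 * (8 * e ^ 3 - 2 * e * b ^ 2) + b ^ 3 by ring]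
    exact (even_two_mul _).add_odd hbo.pow
  have hab : IsCoprime (4 * e) b := by
    refine .mul_left ?_ heb
    rw [show (4 : ℤ) = 2 ^ 2 by rfl]
    obtain ⟨k, rfl⟩ := hbo
    exact IsCoprime.pow_left ⟨-k, 1, by ring⟩
  have hf : 32 * e ^ 3 - 16 * e ^ 2 * b + b ^ 3 ∣
      (4 * e) ^ 3 - 2 * (4 * e) ^ 2 * b + 2 * b ^ 3 := ⟨2, by ring⟩
  have hg : 16 * e ^ 3 - 4 * e * b ^ 2 + b ^ 3 ∣
      (4 * e) ^ 3 - 4 * (4 * e) * b ^ 2 + 4 * b ^ 3 := ⟨4, by ring⟩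
  have hh : 32 * e ^ 3 + 16 * e ^ 2 * b - b ^ 3 ∣
      (4 * e) ^ 3 + 2 * (4 * e) ^ 2 * b - 2 * b ^ 3 := ⟨2, by ring⟩
  have hcop := isCoprime_first_mul hab hfo hf hg hh
  have hcop' := isCoprime_or_eleven_dvd hab hgo hg hh
  have hecop : IsCoprime e ((32 * e ^ 3 - 16 * e ^ 2 * b + b ^ 3) *
      ((16 * e ^ 3 - 4 * e * b ^ 2 + b ^ 3) * (32 * e ^ 3 + 16 * e ^ 2 * b - b ^ 3))) := by
    have h3 : IsCoprime e (b ^ 3) := heb.pow_right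
    rw [show 32 * e ^ 3 - 16 * e ^ 2 * b + b ^ 3 = b ^ 3 + e * (32 * e ^ 2 - 16 * e * b) by ring,
      show 16 * e ^ 3 - 4 * e * b ^ 2 + b ^ 3 = b ^ 3 + e * (16 * e ^ 2 - 4 * b ^ 2) by ring,
      show 32 * e ^ 3 + 16 * e ^ 2 * b - b ^ 3 = -b ^ 3 + e * (32 * e ^ 2 + 16 * e * b) by ring]
    exact .mul_right (h3.add_mul_left_right _)
      (.mul_right (h3.add_mul_left_right _) (h3.neg_right.add_mul_left_right _))
  obtain ⟨s, z, hs, rfl, hz⟩ := exists_sq_of_isCoprime_of_mul_eq_sq he hecop h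
  obtain ⟨d, x, w, hd, hx, hw⟩ := eq_mul_sq_of_isCoprime (c := 1) (z := z) hcop (.inl rfl)
    (by rw [hz, one_mul]) (Int.ne_zero_of_odd hfo)
  rw [mul_one] at hw
  rcases hcop' with hcop' | ⟨⟨n, hn⟩, ⟨m, hm⟩, h11⟩
  · obtain ⟨c, t, -, hc, ht, -⟩ := eq_mul_sq_of_isCoprime hcop' hd hw (Int.ne_zero_of_odd hgo)
    exact ⟨s, t, c, hc, rfl, ht⟩
  · exfalso
    rcases hd with rfl | rfl
    · have hbx : (b : ZMod 8) ^ 3 = 1 := by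
        have hxo : Odd x := by
          rw [hx] at hfo
          simpa [Int.odd_pow', parity_simps] using hfo
        have h8 := congrArg (Int.cast : ℤ → ZMod 8) hx
        have h32 : (32 : ZMod 8) = 0 := by decide
        have h16 : (16 : ZMod 8) = 0 := by decide
        push_cast at h8
        rw [hxo.intCast_zmod_eight_sq, h32, h16] at h8
        simpa using h8
      have hnm : IsCoprime n m := by
        refine Int.isCoprime_of_odd_of_prime_dvd ?_ fun p hp h2 hpn hpm => ?_
        · rw [hn] at hgo
          exact (Int.odd_mul.1 hgo).2
        · have hp11 := (hp.dvd_eleven_of_dvd_second_third h2 hab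
            ((hpn.trans (Dvd.intro_left _ hn.symm)).trans hg)
            ((hpm.trans (Dvd.intro_left _ hm.symm)).trans hh)).1
          have h11p := (hp.associated_of_dvd Int.prime_eleven hp11).symm.dvd
          refine not_sq_eleven_dvd_second_third hab h11 (dvd_trans ?_ hg) (dvd_trans ?_ hh)
          · rw [hn, sq]; exact mul_dvd_mul_left _ (h11p.trans hpn)
          · rw [hm, sq]; exact mul_dvd_mul_left _ (h11p.trans hpm)
      obtain ⟨w, rfl⟩ : 11 ∣ w := by
        apply Int.prime_eleven.dvd_of_dvd_pow (n := 2)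
        rw [← one_mul (w ^ 2), ← hw, hn]
        exact ⟨n * (32 * (s ^ 2) ^ 3 + 16 * (s ^ 2) ^ 2 * b - b ^ 3), by ring⟩
      obtain ⟨c, t, r, hc, -, hr⟩ := eq_mul_sq_of_isCoprime (c := 1) (z := w) hnm (.inl rfl)
        (by rw [hn, hm] at hw; linarith) (by
          rintro rfl
          rw [hn] at hgo
          simp at hgo)
      have h8 := congrArg (Int.cast : ℤ → ZMod 8) hm
      have hro : Odd r := by
        rw [← Int.not_even_iff_odd]
        rintro ⟨k, rfl⟩
        have : Even (b ^ 3) := ⟨16 * (s ^ 2) ^ 3 + 8 * (s ^ 2) ^ 2 * b - 22 * c * k ^ 2, by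
          rw [hr] at hm
          linear_combination -hm⟩
        exact (Int.not_even_iff_odd.2 hbo.pow) this
      rw [hr] at h8
      have h32 : (32 : ZMod 8) = 0 := by decide
      have h16 : (16 : ZMod 8) = 0 := by decide
      push_cast at h8
      rw [hro.intCast_zmod_eight_sq, h32, h16, hbx] at h8
      rcases hc with rfl | rfl <;> revert h8 <;> simp <;> decide
    · have hs11 := eleven_dvd_of_sq_eq_mul_sq (x := x) (y := 8 * s ^ 3) (m := m) (.inr rfl)
        (by linarith)
      have hs11 := Int.prime_eleven.dvd_of_dvd_pow
        ((Int.prime_eleven.dvd_or_dvd hs11).resolve_left (by decide))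
      refine Int.prime_eleven.not_dvd_of_isCoprime_of_dvd heb (hs11.trans ⟨s, sq s⟩) ?_
      have := hs11.trans ⟨s, sq s⟩
      omega

end Factors

theorem eq_of_mul_cubics_eq_sq {a b y : ℤ} (ha : 0 < a) (hb : b ≠ 0) (hab : IsCoprime a b)
    (h : a * ((a ^ 3 - 2 * a ^ 2 * b + 2 * b ^ 3) * ((a ^ 3 - 4 * a * b ^ 2 + 4 * b ^ 3) *
      (a ^ 3 + 2 * a ^ 2 * b - 2 * b ^ 3))) = y ^ 2) : a = b := by
  have ha' : (a : ℚ) ≠ 0 := by exact_mod_cast ha.ne'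
  have hb' : (b : ℚ) ≠ 0 := by exact_mod_cast hb
  suffices ∃ s z d : ℤ, (d = 1 ∨ d = -1) ∧ a = s ^ 2 ∧
      a ^ 3 - 4 * a * b ^ 2 + 4 * b ^ 3 = d * z ^ 2 by
    obtain ⟨s, z, d, hd, has, hz⟩ := this
    have hdd : (d : ℚ) * d = 1 := by rcases hd with rfl | rfl <;> norm_num
    have hs' : (a : ℚ) = s ^ 2 := by exact_mod_cast has
    have hz' : (a ^ 3 - 4 * a * b ^ 2 + 4 * b ^ 3 : ℚ) = d * z ^ 2 := by exact_mod_cast hz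
    have hs0 : (s : ℚ) ≠ 0 := fun h0 => ha' (by simp [hs', h0])
    obtain ⟨-, hu | hu⟩ := Rat.eq_zero_or_one_of_cubic_eq_sq (u := b / a) (y := z / s ^ 3) hd (by
      have e : (d * (4 * (b / a) ^ 3 - 4 * (b / a) ^ 2 + 1) : ℚ) =
          d * (a ^ 3 - 4 * a * b ^ 2 + 4 * b ^ 3) / a ^ 3 := by
        field_simp; ring
      rw [e, hz', ← mul_assoc, hdd, hs']
      field_simp)
    · exact absurd hu (div_ne_zero hb' ha')
    · rw [div_eq_one_iff_eq ha'] at hu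
      exact_mod_cast hu.symm
  obtain ⟨c, rfl | rfl⟩ := Int.even_or_odd' a
  · have hbo : Odd b := by
      rw [← Int.not_even_iff_odd, even_iff_two_dvd]
      exact fun hb => absurd (hab.isUnit_of_dvd' (dvd_mul_right 2 c) hb) (by decide)
    set G := (4 * c ^ 3 - 4 * c ^ 2 * b + b ^ 3) * ((2 * c ^ 3 - 2 * c * b ^ 2 + b ^ 3) *
      (4 * c ^ 3 + 4 * c ^ 2 * b - b ^ 3)) with hG
    have hGo : ¬ 2 ∣ G := by
      rw [← even_iff_two_dvd, hG]
      have := Int.not_even_iff_odd.2 hbo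
      simp [parity_simps, this]
    have two_dvd_of_sq {k w : ℤ} (hw : 2 * k = w ^ 2) : 2 ∣ w :=
      Int.prime_two.dvd_of_dvd_pow (n := 2) ⟨k, hw.symm⟩
    obtain ⟨y, rfl⟩ := two_dvd_of_sq (k := 16 * c * G) (by rw [← h, hG]; ring)
    obtain ⟨y, rfl⟩ := two_dvd_of_sq (k := 4 * c * G) (w := y) (by linarith)
    obtain ⟨y, rfl⟩ := two_dvd_of_sq (k := c * G) (w := y) (by linarith)
    obtain ⟨e, rfl⟩ : 2 ∣ c :=
      (Int.prime_two.dvd_or_dvd ⟨y ^ 2, by linarith⟩).resolve_right hGo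
    obtain ⟨s, z, d, hd, rfl, hz⟩ := exists_second_eq_mul_sq_of_even (e := e) (b := b) (y := y)
      (by omega) hbo (hab.of_isCoprime_of_dvd_left ⟨4, by ring⟩) (by linarith)
    exact ⟨2 * s, 2 * z, d, hd, by ring, by linear_combination 4 * hz⟩
  · exact exists_second_eq_mul_sq_of_odd ha (odd_two_mul_add_one c) hab h

/-- The affine rational points of the hyperelliptic model of the modular curve `X₀(176)*`. -/
theorem X0_176_star_affine_rational_points (x y : ℚ) :
    y ^ 2 = x * (x ^ 3 - 2 * x ^ 2 + 2) * (x ^ 3 - 4 * x + 4) * (x ^ 3 + 2 * x ^ 2 - 2) ↔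
      (x, y) = (0, 0) ∨ (x, y) = (1, 1) ∨ (x, y) = (1, -1) := by
  simp only [Prod.mk.injEq]
  refine ⟨fun h => ?_, ?_⟩
  · by_cases hx : x = 0
    · subst hx
      exact .inl ⟨rfl, by simpa using h⟩
    suffices hx1 : x = 1 by
      subst hx1
      have : y ^ 2 = 1 := by rw [h]; norm_num
      rcases sq_eq_sq_iff_eq_or_eq_neg.1 (this.trans (one_pow 2).symm) with h | h <;> simp [h]
    obtain ⟨a, b, ha, hb, hab, hxab⟩ : ∃ a b : ℤ, 0 < a ∧ b ≠ 0 ∧ IsCoprime a b ∧ x = a / b := by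
      have hden : (x.den : ℤ) ≠ 0 := by exact_mod_cast x.den_nz
      have hx' : x = x.num / (x.den : ℤ) := by simpa using (Rat.num_div_den x).symm
      rcases lt_or_gt_of_ne (Rat.num_ne_zero.2 hx) with hn | hn
      · exact ⟨-x.num, -x.den, by omega, by omega, (Rat.isCoprime_num_den x).neg_neg, by
          rw [Int.cast_neg, Int.cast_neg, neg_div_neg_eq, ← hx']⟩
      · exact ⟨x.num, x.den, hn, hden, Rat.isCoprime_num_den x, hx'⟩
    have hb' : (b : ℚ) ≠ 0 := by exact_mod_cast hb
    have key : (y * b ^ 5) ^ 2 = ((a * ((a ^ 3 - 2 * a ^ 2 * b + 2 * b ^ 3) *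
        ((a ^ 3 - 4 * a * b ^ 2 + 4 * b ^ 3) * (a ^ 3 + 2 * a ^ 2 * b - 2 * b ^ 3))) : ℤ) : ℚ) := by
      have hxb : (a : ℚ) = x * b := by rw [hxab]; field_simp
      push_cast
      rw [mul_pow, h, hxb]
      ring
    obtain ⟨m, hm⟩ := Rat.exists_int_eq_of_sq_eq key
    rw [hm] at key
    rw [hxab, eq_of_mul_cubics_eq_sq ha hb hab (by exact_mod_cast key.symm), div_self hb']
  · rintro (⟨rfl, rfl⟩ | ⟨rfl, rfl⟩ | ⟨rfl, rfl⟩) <;> norm_num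
end
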